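/- Let u⃗ = (u_1,…,u_μ) ∈ S_ind(n,s) be a vector valued cusp form for Γ₀(n) and define (Pu⃗)_i(ζ) = ∫_0^∞ ( u_i(iy)(∂_x R_ζ^s)(iy) − R_ζ^s(iy)(∂_x u_i)(iy) ) dy for ζ > 0 (the integral of η(u_i, R_ζ^s) along the geodesic from 0 to i∞). Then these integrals converge and Pu⃗ satisfies the three term equation Pu⃗(ζ) = ρ(T^{−1}) Pu⃗(ζ+1) + (ζ+1)^{−2s} ρ(T′^{−1}) Pu⃗(ζ/(ζ+1)) for all ζ > 0, where T = [[1,1],[0,1]] and T′ = [[1,0],[1,1]]. -/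

import Mathlib

noncomputable section

open Complex MeasureTheory

/- ## Farey machinery -/

/-- The Farey sequence of level `n`, as a subset of the extended reals;
`⊥ = -∞ = -1/0`, `⊤ = ∞ = 1/0`. -/
def fareySet (n : ℕ) : Set EReal :=
  {⊥, ⊤, 0} ∪ {x : EReal | ∃ q : ℚ, x = ((q : ℝ) : EReal) ∧ q.num.natAbs ≤ n ∧ q.den ≤ n}

/-- The level of an element of `ℚ ∪ {±∞}`. -/
def flev (x : EReal) : ℕ := sInf {n : ℕ | x ∈ fareySet n}

/-- The left neighbor map: the largest element of `F_{lev x}` strictly below `x`. -/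
def fLN (x : EReal) : EReal := sSup {r : EReal | r ∈ fareySet (flev x) ∧ r < x}

/-- The length `L` of the left neighbor sequence: the least `L` with `LN^L q = -∞`. -/
def fL (x : EReal) : ℕ := sInf {L : ℕ | fLN^[L] x = ⊥}

/-- The members `y_l = LN^{L-l}(q)` of the left neighbor sequence `LNS(q)`. -/
def yseq (q : ℚ) (l : ℕ) : EReal := fLN^[fL ((q : ℝ) : EReal) - l] ((q : ℝ) : EReal)

/-- The fraction `a/c` as an element of `ℚ ∪ {±∞}` (with `1/0 = ∞`, `-1/0 = -∞`). -/
def efrac (a c : ℤ) : EReal :=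
  if c = 0 then (if 0 < a then ⊤ else ⊥) else ((((a : ℚ) / (c : ℚ) : ℚ) : ℝ) : EReal)

open Classical in
/-- The numerator of an element of `ℚ ∪ {±∞}` in lowest terms (`-∞ = -1/0`, `∞ = 1/0`). -/
def enum (x : EReal) : ℤ :=
  if x = ⊥ then -1
  else if x = ⊤ then 1
  else if h : ∃ q : ℚ, x = ((q : ℝ) : EReal) then h.choose.num else 0

open Classical in
/-- The (nonnegative) denominator of an element of `ℚ ∪ {±∞}` in lowest terms. -/
def eden (x : EReal) : ℤ :=
  if x = ⊥ then 0
  else if x = ⊤ then 0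
  else if h : ∃ q : ℚ, x = ((q : ℝ) : EReal) then (h.choose.den : ℤ) else 0

/-- The matrix `m_l = [[b_l, -a_l], [b_{l-1}, -a_{l-1}]]` from `M(q) = Σ_l m_l`. -/
def mMat (q : ℚ) (l : ℕ) : Matrix (Fin 2) (Fin 2) ℤ :=
  !![eden (yseq q l), -enum (yseq q l); eden (yseq q (l - 1)), -enum (yseq q (l - 1))]

/- ## Matrix groups -/

abbrev SL2 := Matrix.SpecialLinearGroup (Fin 2) ℤ

/-- The Hecke congruence subgroup `Γ₀(n)` inside `SL₂(ℤ)`. -/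
def Gam0 (n : ℕ) : Set SL2 := {g : SL2 | (n : ℤ) ∣ (g : Matrix (Fin 2) (Fin 2) ℤ) 1 0}

/-- `X_m`: upper triangular integer matrices `[[a,b],[0,d]]` with `ad = m`, `d > b ≥ 0`. -/
def Xset (m : ℕ) : Set (Matrix (Fin 2) (Fin 2) ℤ) :=
  {A | A 1 0 = 0 ∧ A 0 0 * A 1 1 = (m : ℤ) ∧ 0 ≤ A 0 1 ∧ A 0 1 < A 1 1}

/-- `X_m` as a finite set. -/
def XF (m : ℕ) : Finset (Matrix (Fin 2) (Fin 2) ℤ) :=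
  ((m.divisors ×ˢ Finset.range m).filter fun p => p.2 < p.1).image
    fun p => !![((m / p.1 : ℕ) : ℤ), (p.2 : ℤ); 0, (p.1 : ℤ)]

/-- Möbius action of an integer matrix on (a suitable part of) `ℂ`. -/
def moeb (g : Matrix (Fin 2) (Fin 2) ℤ) (z : ℂ) : ℂ :=
  ((g 0 0 : ℂ) * z + (g 0 1 : ℂ)) / ((g 1 0 : ℂ) * z + (g 1 1 : ℂ))

/-- `α : Fin μ → SL₂(ℤ)` is a full set of representatives of the right cosets
`Γ₀(n) \ SL₂(ℤ)`. -/
def IsCosetReps (n : ℕ) {μ : ℕ} (α : Fin μ → SL2) : Prop :=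
  (∀ g : SL2, ∃ j : Fin μ, ∃ γ ∈ Gam0 n, g = γ * α j) ∧
  (∀ j k : Fin μ, (∃ γ ∈ Gam0 n, α j = γ * α k) → j = k)

open Classical in
/-- The representation of `SL₂(ℤ)` induced from the trivial representation of `Γ₀(n)`:
a permutation matrix realization of the right regular representation. -/
def rho (n : ℕ) {μ : ℕ} (α : Fin μ → SL2) (g : SL2) : Matrix (Fin μ) (Fin μ) ℂ :=
  fun i j => if α i * g * (α j)⁻¹ ∈ Gam0 n then 1 else 0

/- ## Analysis -/

/-- Partial derivative in the `x` (real) direction. -/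
def pdx (f : ℂ → ℂ) (z : ℂ) : ℂ := deriv (fun x : ℝ => f (x + z.im * Complex.I)) z.re

/-- Partial derivative in the `y` (imaginary) direction. -/
def pdy (f : ℂ → ℂ) (z : ℂ) : ℂ := deriv (fun y : ℝ => f (z.re + y * Complex.I)) z.im

/-- The hyperbolic Laplacian `Δ = -y²(∂_x² + ∂_y²)`. -/
def laplace (f : ℂ → ℂ) (z : ℂ) : ℂ := -(z.im : ℂ) ^ 2 * (pdx (pdx f) z + pdy (pdy f) z)

/-- `R_ζ(z) = Im z / |z - ζ|²`. -/
def Rfun (ζ : ℝ) (z : ℂ) : ℝ := z.im / ((z.re - ζ) ^ 2 + z.im ^ 2)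

/-- `R_ζ^s(z)`, using the principal branch on the positive real `R_ζ(z)`. -/
def Rpow (s : ℂ) (ζ : ℝ) (z : ℂ) : ℂ := ((Rfun ζ z : ℝ) : ℂ) ^ s

/-- A Maass cusp form for `Γ₀(n)` with spectral parameter `s`. -/
structure IsCuspForm (n : ℕ) (s : ℂ) (u : ℂ → ℂ) : Prop where
  analytic : AnalyticOnNhd ℝ u {z : ℂ | 0 < z.im}
  invar : ∀ g ∈ Gam0 n, ∀ z : ℂ, 0 < z.im → u (moeb g z) = u z
  eigen : ∀ z : ℂ, 0 < z.im → laplace u z = s * (1 - s) * u z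
  decay : ∀ g : SL2, ∀ C : ℝ, ∃ K T : ℝ, ∀ z : ℂ, 0 < z.im → T ≤ z.im →
    ‖u (moeb g z)‖ ≤ K * z.im ^ C

/-- A vector valued cusp form for `Γ₀(n)` with spectral parameter `s`. -/
structure IsVVCuspForm (n : ℕ) {μ : ℕ} (α : Fin μ → SL2) (s : ℂ) (U : ℂ → Fin μ → ℂ) :
    Prop where
  analytic : ∀ j, AnalyticOnNhd ℝ (fun z => U z j) {z : ℂ | 0 < z.im}
  equivar : ∀ g : SL2, ∀ z : ℂ, 0 < z.im → ∀ j,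
    U (moeb g z) j = ∑ k, rho n α g j k * U z k
  eigen : ∀ j, ∀ z : ℂ, 0 < z.im → laplace (fun w => U w j) z = s * (1 - s) * U z j
  decay : ∀ j, ∀ C : ℝ, ∃ K T : ℝ, ∀ z : ℂ, 0 < z.im → T ≤ z.im → ‖U z j‖ ≤ K * z.im ^ C

/-- The map `Π` from cusp forms to vector valued cusp forms. -/
def PiMap {μ : ℕ} (α : Fin μ → SL2) (u : ℂ → ℂ) : ℂ → Fin μ → ℂ :=
  fun z j => u (moeb (α j : Matrix (Fin 2) (Fin 2) ℤ) z)

/-- The integral transform `P`, componentwise: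
`(Pu)(ζ) = ∫_0^∞ (u(iy) ∂_x R_ζ^s(iy) - R_ζ^s(iy) ∂_x u(iy)) dy`. -/
def Ptrans (s : ℂ) (v : ℂ → ℂ) (ζ : ℝ) : ℂ :=
  ∫ y in Set.Ioi (0 : ℝ),
    (v (y * Complex.I) * pdx (Rpow s ζ) (y * Complex.I)
      - Rpow s ζ (y * Complex.I) * pdx v (y * Complex.I))

def Tmat : SL2 := ⟨!![1, 1; 0, 1], by norm_num [Matrix.det_fin_two_of]⟩

def Tmat' : SL2 := ⟨!![1, 0; 1, 1], by norm_num [Matrix.det_fin_two_of]⟩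

/-- A (vector valued) period function for `Γ₀(n)` with spectral parameter `s`. -/
structure IsPeriodFn (n : ℕ) {μ : ℕ} (α : Fin μ → SL2) (s : ℂ) (ψ : ℝ → Fin μ → ℂ) :
    Prop where
  analytic : ∀ i, AnalyticOnNhd ℝ (fun ζ => ψ ζ i) (Set.Ioi 0)
  threeterm : ∀ ζ : ℝ, 0 < ζ → ∀ i,
    ψ ζ i = ∑ k, rho n α Tmat⁻¹ i k * ψ (ζ + 1) k
      + ((ζ + 1 : ℝ) : ℂ) ^ (-(2 * s)) * ∑ k, rho n α Tmat'⁻¹ i k * ψ (ζ / (ζ + 1)) k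
  grow0 : ∀ i, ∃ K ε : ℝ, 0 < ε ∧ ∀ ζ : ℝ, 0 < ζ → ζ < ε →
    ‖ψ ζ i‖ ≤ K * ζ ^ (max 0 (-2 * s.re))
  growInf : ∀ i, ∃ K T : ℝ, ∀ ζ : ℝ, T ≤ ζ → 0 < ζ →
    ‖ψ ζ i‖ ≤ K * ζ ^ (min 0 (-2 * s.re))


open Filter Topology Set in
theorem IsLocalMin.secondDeriv_nonneg {f f' : ℝ → ℝ} {a c : ℝ}
    (h : ∀ᶠ x in 𝓝 a, HasDerivAt f (f' x) x) (h2 : HasDerivAt f' c a)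
    (hmin : IsLocalMin f a) : 0 ≤ c := by
  by_contra! hc
  have e1 : deriv f =ᶠ[𝓝 a] f' := h.mono fun x hx => hx.deriv
  have e2 : deriv (deriv f) a = c := by rw [e1.deriv_eq, h2.deriv]
  have hmax : IsLocalMax f a :=
    isLocalMax_of_deriv_deriv_neg (by rwa [e2]) hmin.deriv_eq_zero h.self_of_nhds.continuousAt
  have e3 : f =ᶠ[𝓝 a] fun _ => f a := by
    filter_upwards [hmin, hmax] with x h1 h2 using le_antisymm h2 h1
  have e4 : deriv f =ᶠ[𝓝 a] fun _ => 0 := by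
    simpa using e3.deriv
  rw [e4.deriv_eq] at e2
  simp at e2
  linarith

open Filter Topology Set in
/-- The minimum principle for strictly superharmonic functions on the rectangle
`[0, 1] × [-1, 1]`. -/
theorem nonneg_of_superharmonic_rectangle {h hx hxx hy hyy : ℝ → ℝ → ℝ}
    (hc : ContinuousOn (fun p : ℝ × ℝ => h p.1 p.2) (Icc 0 1 ×ˢ Icc (-1) 1))
    (d1 : ∀ x ∈ Ioo (0 : ℝ) 1, ∀ y ∈ Ioo (-1 : ℝ) 1, HasDerivAt (fun t => h t y) (hx x y) x)
    (d2 : ∀ x ∈ Ioo (0 : ℝ) 1, ∀ y ∈ Ioo (-1 : ℝ) 1, HasDerivAt (fun t => hx t y) (hxx x y) x)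
    (d3 : ∀ x ∈ Ioo (0 : ℝ) 1, ∀ y ∈ Ioo (-1 : ℝ) 1, HasDerivAt (fun t => h x t) (hy x y) y)
    (d4 : ∀ x ∈ Ioo (0 : ℝ) 1, ∀ y ∈ Ioo (-1 : ℝ) 1, HasDerivAt (fun t => hy x t) (hyy x y) y)
    (hlap : ∀ x ∈ Ioo (0 : ℝ) 1, ∀ y ∈ Ioo (-1 : ℝ) 1, hxx x y + hyy x y < 0)
    (b1 : ∀ y ∈ Icc (-1 : ℝ) 1, 0 ≤ h 0 y) (b2 : ∀ y ∈ Icc (-1 : ℝ) 1, 0 ≤ h 1 y)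
    (b3 : ∀ x ∈ Icc (0 : ℝ) 1, 0 ≤ h x (-1)) (b4 : ∀ x ∈ Icc (0 : ℝ) 1, 0 ≤ h x 1) :
    ∀ x ∈ Icc (0 : ℝ) 1, ∀ y ∈ Icc (-1 : ℝ) 1, 0 ≤ h x y := by
  obtain ⟨⟨a, b⟩, ⟨ha, hb⟩, hm⟩ := (isCompact_Icc.prod isCompact_Icc).exists_isMinOn
    (⟨(0, 0), by simp⟩ : (Icc (0 : ℝ) 1 ×ˢ Icc (-1 : ℝ) 1).Nonempty) hc
  dsimp only at ha hb
  suffices H : 0 ≤ h a b from fun x hx y hy => H.trans (hm (mk_mem_prod hx hy))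
  rcases ha.1.eq_or_lt with rfl | ha1
  · exact b1 b hb
  rcases ha.2.eq_or_lt with rfl | ha2
  · exact b2 b hb
  rcases hb.1.eq_or_lt with rfl | hb1
  · exact b3 a ha
  rcases hb.2.eq_or_lt with rfl | hb2
  · exact b4 a ha
  have hax : ∀ᶠ x in 𝓝 a, x ∈ Ioo (0 : ℝ) 1 := Ioo_mem_nhds ha1 ha2
  have hby : ∀ᶠ y in 𝓝 b, y ∈ Ioo (-1 : ℝ) 1 := Ioo_mem_nhds hb1 hb2
  have k1 : 0 ≤ hxx a b := IsLocalMin.secondDeriv_nonneg (f := fun t => h t b)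
    (hax.mono fun x hx => d1 x hx b ⟨hb1, hb2⟩) (d2 a ⟨ha1, ha2⟩ b ⟨hb1, hb2⟩)
    (hax.mono fun x hx => hm (mk_mem_prod (Ioo_subset_Icc_self hx) hb))
  have k2 : 0 ≤ hyy a b := IsLocalMin.secondDeriv_nonneg (f := fun t => h a t)
    (hby.mono fun y hy => d3 a ⟨ha1, ha2⟩ y hy) (d4 a ⟨ha1, ha2⟩ b ⟨hb1, hb2⟩)
    (hby.mono fun y hy => hm (mk_mem_prod ha (Ioo_subset_Icc_self hy)))
  linarith [hlap a ⟨ha1, ha2⟩ b ⟨hb1, hb2⟩]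

open Filter Topology Set in
/-- One-sided interior gradient estimate for the Poisson equation on the square `[-1, 1]²`. -/
theorem partial_le_of_laplacian_bound {u ux uxx uy uyy : ℝ → ℝ → ℝ} {M N : ℝ}
    (hc : ContinuousOn (fun p : ℝ × ℝ => u p.1 p.2) (Icc (-1) 1 ×ˢ Icc (-1) 1))
    (d1 : ∀ x ∈ Icc (-1 : ℝ) 1, ∀ y ∈ Icc (-1 : ℝ) 1, HasDerivAt (fun t => u t y) (ux x y) x)
    (d2 : ∀ x ∈ Icc (-1 : ℝ) 1, ∀ y ∈ Icc (-1 : ℝ) 1, HasDerivAt (fun t => ux t y) (uxx x y) x)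
    (d3 : ∀ x ∈ Icc (-1 : ℝ) 1, ∀ y ∈ Icc (-1 : ℝ) 1, HasDerivAt (fun t => u x t) (uy x y) y)
    (d4 : ∀ x ∈ Icc (-1 : ℝ) 1, ∀ y ∈ Icc (-1 : ℝ) 1, HasDerivAt (fun t => uy x t) (uyy x y) y)
    (hM : ∀ x ∈ Icc (-1 : ℝ) 1, ∀ y ∈ Icc (-1 : ℝ) 1, |u x y| ≤ M)
    (hN : ∀ x ∈ Icc (-1 : ℝ) 1, ∀ y ∈ Icc (-1 : ℝ) 1, |uxx x y + uyy x y| < N) :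
    ux 0 0 ≤ 2 * M + N / 2 := by
  have hM0 : 0 ≤ M := (abs_nonneg _).trans (hM 0 (by simp) 0 (by simp))
  have hN0 : 0 < N := (abs_nonneg _).trans_lt (hN 0 (by simp) 0 (by simp))
  have pos : ∀ {x : ℝ}, x ∈ Icc (0 : ℝ) 1 → x ∈ Icc (-1 : ℝ) 1 := fun h =>
    ⟨by linarith [h.1], h.2⟩
  have neg : ∀ {x : ℝ}, x ∈ Icc (0 : ℝ) 1 → -x ∈ Icc (-1 : ℝ) 1 := fun h =>
    ⟨by linarith [h.2], by linarith [h.1]⟩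
  have key := nonneg_of_superharmonic_rectangle
    (h := fun x y => M * (y ^ 2 + x * (2 - x)) + N / 2 * (x * (1 - x)) - (u x y - u (-x) y) / 2)
    (hx := fun x y => M * (2 - 2 * x) + N / 2 * (1 - 2 * x) - (ux x y + ux (-x) y) / 2)
    (hxx := fun x y => M * (-2) + N / 2 * (-2) - (uxx x y - uxx (-x) y) / 2)
    (hy := fun x y => M * (2 * y) - (uy x y - uy (-x) y) / 2)
    (hyy := fun x y => M * 2 - (uyy x y - uyy (-x) y) / 2) ?_ ?_ ?_ ?_ ?_ ?_ ?_ ?_ ?_ ?_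
  · have hd := ((((hasDerivAt_id (0 : ℝ)).mul ((hasDerivAt_id (0 : ℝ)).const_sub 2)).const_mul M).add
      (((hasDerivAt_id (0 : ℝ)).mul ((hasDerivAt_id (0 : ℝ)).const_sub 1)).const_mul (N / 2))).sub
      (((d1 0 (by simp) 0 (by simp)).sub
        ((by simpa using d1 0 (by simp) 0 (by simp) :
          HasDerivAt (fun t => u t 0) (ux 0 0) (-0)).comp (0 : ℝ) (hasDerivAt_neg (0 : ℝ)))).div_const 2)
    rw [hasDerivAt_iff_tendsto_slope] at hd
    have h0 := ge_of_tendsto (b := (0 : ℝ)) (hd.mono_left (nhdsWithin_mono 0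
      (fun x (hx : x ∈ Ioi (0 : ℝ)) => (ne_of_gt hx : x ≠ 0)))) (by
        filter_upwards [Ioo_mem_nhdsGT (zero_lt_one' ℝ)] with x hx
        have := key x (Ioo_subset_Icc_self hx) 0 (by simp)
        simp [slope_def_field]
        apply div_nonneg _ hx.1.le
        simp at this ⊢
        linarith)
    simp at h0
    linarith
  · have hc1 : ContinuousOn (fun p : ℝ × ℝ => u p.1 p.2) (Icc 0 1 ×ˢ Icc (-1) 1) :=
      hc.mono (prod_mono (fun _ h => pos h) subset_rfl)
    have hc2 : ContinuousOn (fun p : ℝ × ℝ => u (-p.1) p.2) (Icc 0 1 ×ˢ Icc (-1) 1) :=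
      hc.comp (f := fun p : ℝ × ℝ => (-p.1, p.2)) (by fun_prop)
        (fun p hp => mk_mem_prod (neg hp.1) hp.2)
    exact ContinuousOn.sub (by fun_prop) ((hc1.sub hc2).div_const 2)
  · intro x hx y hy
    have hx := Ioo_subset_Icc_self hx
    have hy := Ioo_subset_Icc_self hy
    have e := ((((((hasDerivAt_id x).mul ((hasDerivAt_id x).const_sub 2)).const_add (y ^ 2)).const_mul
      M).add (((hasDerivAt_id x).mul ((hasDerivAt_id x).const_sub 1)).const_mul (N / 2))).sub
      (((d1 x (pos hx) y hy).sub ((d1 (-x) (neg hx) y hy).comp x (hasDerivAt_neg x))).div_const 2))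
    exact e.congr_deriv (by simp; ring)
  · intro x hx y hy
    have hx := Ioo_subset_Icc_self hx
    have hy := Ioo_subset_Icc_self hy
    have e := (((((hasDerivAt_id x).const_mul 2).const_sub 2).const_mul
      M).add ((((hasDerivAt_id x).const_mul 2).const_sub 1).const_mul (N / 2))).sub
      (((d2 x (pos hx) y hy).add ((d2 (-x) (neg hx) y hy).comp x (hasDerivAt_neg x))).div_const 2)
    exact e.congr_deriv (by simp; ring)
  · intro x hx y hy
    have hx := Ioo_subset_Icc_self hx
    have hy := Ioo_subset_Icc_self hy
    have e := (((((hasDerivAt_pow 2 y).add_const (x * (2 - x))).const_mul M).add_const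
      (N / 2 * (x * (1 - x)))).sub
      (((d3 x (pos hx) y hy).sub (d3 (-x) (neg hx) y hy)).div_const 2))
    exact e.congr_deriv (by simp)
  · intro x hx y hy
    have hx := Ioo_subset_Icc_self hx
    have hy := Ioo_subset_Icc_self hy
    have e := (((hasDerivAt_id y).const_mul 2).const_mul M).sub
      (((d4 x (pos hx) y hy).sub (d4 (-x) (neg hx) y hy)).div_const 2)
    exact e.congr_deriv (by simp)
  · intro x hx y hy
    have hx := Ioo_subset_Icc_self hx
    have hy := Ioo_subset_Icc_self hy
    have h1 := abs_lt.1 (hN x (pos hx) y hy)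
    have h2 := abs_lt.1 (hN (-x) (neg hx) y hy)
    linarith [h1.1, h2.2, h1.2, h2.1]
  · intro y hy
    simp
    positivity
  · intro y hy
    have h1 := abs_le.1 (hM 1 (by simp) y hy)
    have h2 := abs_le.1 (hM (-1) (by simp) y hy)
    have : 0 ≤ M * y ^ 2 := by positivity
    norm_num
    linarith [h1.2, h2.1]
  · intro x hx
    have h1 := abs_le.1 (hM x (pos hx) (-1) (by simp))
    have h2 := abs_le.1 (hM (-x) (neg hx) (-1) (by simp))
    have : 0 ≤ M * (x * (2 - x)) := mul_nonneg hM0 (mul_nonneg hx.1 (by linarith [hx.2]))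
    have : 0 ≤ N / 2 * (x * (1 - x)) :=
      mul_nonneg (by linarith) (mul_nonneg hx.1 (by linarith [hx.2]))
    norm_num
    linarith [h1.2, h2.1]
  · intro x hx
    have h1 := abs_le.1 (hM x (pos hx) 1 (by simp))
    have h2 := abs_le.1 (hM (-x) (neg hx) 1 (by simp))
    have : 0 ≤ M * (x * (2 - x)) := mul_nonneg hM0 (mul_nonneg hx.1 (by linarith [hx.2]))
    have : 0 ≤ N / 2 * (x * (1 - x)) :=
      mul_nonneg (by linarith) (mul_nonneg hx.1 (by linarith [hx.2]))
    norm_num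
    linarith [h1.2, h2.1]

theorem isOpen_setOf_im_pos : IsOpen {z : ℂ | 0 < z.im} :=
  isOpen_lt continuous_const Complex.continuous_im

theorem hasDerivAt_comp_line {E : Type*} [NormedAddCommGroup E] [NormedSpace ℝ E] {f : ℂ → E}
    {p e : ℂ} {t : ℝ} (hf : DifferentiableAt ℝ f (p + t * e)) :
    HasDerivAt (fun t : ℝ => f (p + t * e)) (fderiv ℝ f (p + t * e) e) t := by
  have h : HasDerivAt (fun t : ℝ => p + (t : ℂ) * e) e t := by
    simpa using ((Complex.ofRealCLM.hasDerivAt (x := t)).mul_const e).const_add p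
  exact hf.hasFDerivAt.comp_hasDerivAt t h

theorem pdx_eq_fderiv {f : ℂ → ℂ} {z : ℂ} (hf : DifferentiableAt ℝ f z) :
    pdx f z = fderiv ℝ f z 1 := by
  have e : ((z.im : ℂ) * Complex.I + (z.re : ℂ) * 1) = z := by
    rw [mul_one, add_comm, Complex.re_add_im]
  have h := hasDerivAt_comp_line (f := f) (p := z.im * Complex.I) (e := 1) (t := z.re)
    (by rwa [e])
  rw [e] at h
  rw [pdx, ← h.deriv]
  congr 1
  funext x
  rw [mul_one, add_comm]

theorem pdy_eq_fderiv {f : ℂ → ℂ} {z : ℂ} (hf : DifferentiableAt ℝ f z) :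
    pdy f z = fderiv ℝ f z Complex.I := by
  have h := hasDerivAt_comp_line (f := f) (p := z.re) (e := Complex.I) (t := z.im)
    (by rwa [Complex.re_add_im])
  rw [Complex.re_add_im] at h
  rw [pdy, ← h.deriv]

theorem pdx_congr {f g : ℂ → ℂ} {z : ℂ} (h : f =ᶠ[nhds z] g) : pdx f z = pdx g z := by
  have hc : Filter.Tendsto (fun x : ℝ => (x : ℂ) + z.im * Complex.I) (nhds z.re) (nhds z) := by
    have : Continuous (fun x : ℝ => (x : ℂ) + z.im * Complex.I) := by fun_prop
    simpa [Complex.re_add_im] using this.tendsto z.re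
  exact Filter.EventuallyEq.deriv_eq (hc.eventually h)

theorem pdy_congr {f g : ℂ → ℂ} {z : ℂ} (h : f =ᶠ[nhds z] g) : pdy f z = pdy g z := by
  have hc : Filter.Tendsto (fun y : ℝ => (z.re : ℂ) + y * Complex.I) (nhds z.im) (nhds z) := by
    have : Continuous (fun y : ℝ => (z.re : ℂ) + y * Complex.I) := by fun_prop
    simpa [Complex.re_add_im] using this.tendsto z.im
  exact Filter.EventuallyEq.deriv_eq (hc.eventually h)

theorem fderiv_fderiv_apply {f : ℂ → ℂ} {z a b : ℂ} (hf : AnalyticAt ℝ f z) :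
    fderiv ℝ (fun w => fderiv ℝ f w a) z b = fderiv ℝ (fderiv ℝ f) z b a := by
  rw [(hf.fderiv.differentiableAt.hasFDerivAt.clm_apply (hasFDerivAt_const a z)).fderiv]
  simp

theorem laplace_eq_fderiv {f : ℂ → ℂ} {z : ℂ} (hf : AnalyticAt ℝ f z) :
    laplace f z = -(z.im : ℂ) ^ 2 * (fderiv ℝ (fderiv ℝ f) z 1 1
      + fderiv ℝ (fderiv ℝ f) z Complex.I Complex.I) := by
  have hd (a : ℂ) : DifferentiableAt ℝ (fun w => fderiv ℝ f w a) z :=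
    hf.fderiv.differentiableAt.clm_apply (differentiableAt_const a)
  have h1 : pdx f =ᶠ[nhds z] fun w => fderiv ℝ f w 1 :=
    hf.eventually_analyticAt.mono fun w hw => pdx_eq_fderiv hw.differentiableAt
  have h2 : pdy f =ᶠ[nhds z] fun w => fderiv ℝ f w Complex.I :=
    hf.eventually_analyticAt.mono fun w hw => pdy_eq_fderiv hw.differentiableAt
  rw [laplace, pdx_congr h1, pdy_congr h2, pdx_eq_fderiv (hd _), pdy_eq_fderiv (hd _),
    fderiv_fderiv_apply hf, fderiv_fderiv_apply hf]

/-- Real-analytic eigenfunctions of the hyperbolic Laplacian on the upper half-plane. -/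
structure IsLaplaceEigen (lam : ℂ) (v : ℂ → ℂ) : Prop where
  analytic : AnalyticOnNhd ℝ v {z : ℂ | 0 < z.im}
  eigen : ∀ z : ℂ, 0 < z.im → laplace v z = lam * v z

theorem IsLaplaceEigen.fderiv_fderiv_add {lam : ℂ} {v : ℂ → ℂ} (hv : IsLaplaceEigen lam v) {z : ℂ}
    (hz : 0 < z.im) :
    fderiv ℝ (fderiv ℝ v) z 1 1 + fderiv ℝ (fderiv ℝ v) z Complex.I Complex.I
      = -(lam * v z) / (z.im : ℂ) ^ 2 := by
  have h := hv.eigen z hz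
  have h0 : (z.im : ℂ) ≠ 0 := by exact_mod_cast hz.ne'
  rw [laplace_eq_fderiv (hv.analytic z hz)] at h
  field_simp
  linear_combination -h

open Set in
theorem IsLaplaceEigen.norm_fderiv_apply_le {lam : ℂ} {v : ℂ → ℂ} (hv : IsLaplaceEigen lam v)
    {z₀ : ℂ} (hz₀ : 2 ≤ z₀.im) {M : ℝ} (hM0 : 0 < M)
    (hM : ∀ z : ℂ, |z.re - z₀.re| ≤ 1 → |z.im - z₀.im| ≤ 1 → ‖v z‖ ≤ M)
    {e : ℂ} (he : e = 1 ∨ e = Complex.I) {c : ℂ} (hc : ‖c‖ = 1) :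
    (c * fderiv ℝ v z₀ e).re ≤ 2 * M + (‖lam‖ + 1) * M / 2 := by
  set P : ℝ → ℝ → ℂ := fun x y => z₀ + e * (x + y * Complex.I) with hP
  have hPc : Continuous (fun p : ℝ × ℝ => P p.1 p.2) := by simp only [hP]; fun_prop
  have hbox : ∀ x ∈ Icc (-1 : ℝ) 1, ∀ y ∈ Icc (-1 : ℝ) 1,
      |(P x y).re - z₀.re| ≤ 1 ∧ |(P x y).im - z₀.im| ≤ 1 := by
    intro x hx y hy
    rcases he with rfl | rfl <;> simp [hP, abs_le, hx.1, hx.2, hy.1, hy.2]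
  have him : ∀ x ∈ Icc (-1 : ℝ) 1, ∀ y ∈ Icc (-1 : ℝ) 1, 1 ≤ (P x y).im := by
    intro x hx y hy
    linarith [(abs_le.1 (hbox x hx y hy).2).1]
  have hpos : ∀ x ∈ Icc (-1 : ℝ) 1, ∀ y ∈ Icc (-1 : ℝ) 1, 0 < (P x y).im := fun x hx y hy =>
    one_pos.trans_le (him x hx y hy)
  have hPx (x y : ℝ) : P x y = (z₀ + e * (y * Complex.I)) + x * e := by simp only [hP]; ring
  have hPy (x y : ℝ) : P x y = (z₀ + e * x) + y * (e * Complex.I) := by simp only [hP]; ring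
  have lineX {f : ℂ → ℂ} {x y : ℝ} (hf : DifferentiableAt ℝ f (P x y)) :
      HasDerivAt (fun t => (c * f (P t y)).re) (c * fderiv ℝ f (P x y) e).re x := by
    simp only [hPx] at hf ⊢
    exact Complex.reCLM.hasFDerivAt.comp_hasDerivAt x ((hasDerivAt_comp_line hf).const_mul c)
  have lineY {f : ℂ → ℂ} {x y : ℝ} (hf : DifferentiableAt ℝ f (P x y)) :
      HasDerivAt (fun t => (c * f (P x t)).re) (c * fderiv ℝ f (P x y) (e * Complex.I)).re y := by
    simp only [hPy] at hf ⊢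
    exact Complex.reCLM.hasFDerivAt.comp_hasDerivAt y ((hasDerivAt_comp_line hf).const_mul c)
  have hd (a : ℂ) {z : ℂ} (hz : 0 < z.im) : DifferentiableAt ℝ (fun w => fderiv ℝ v w a) z :=
    (hv.analytic z hz).fderiv.differentiableAt.clm_apply (differentiableAt_const a)
  have h00 : P 0 0 = z₀ := by simp [hP]
  have key := partial_le_of_laplacian_bound
    (u := fun x y => (c * v (P x y)).re)
    (ux := fun x y => (c * fderiv ℝ v (P x y) e).re)
    (uxx := fun x y => (c * fderiv ℝ (fderiv ℝ v) (P x y) e e).re)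
    (uy := fun x y => (c * fderiv ℝ v (P x y) (e * Complex.I)).re)
    (uyy := fun x y => (c * fderiv ℝ (fderiv ℝ v) (P x y) (e * Complex.I) (e * Complex.I)).re)
    (M := M) (N := (‖lam‖ + 1) * M) ?_ ?_ ?_ ?_ ?_ ?_ ?_
  · simpa only [h00] using key
  · refine Complex.continuous_re.comp_continuousOn (continuousOn_const.mul ?_)
    exact hv.analytic.continuousOn.comp hPc.continuousOn fun p hp => hpos _ hp.1 _ hp.2
  · intro x hx y hy
    exact lineX (hv.analytic _ (hpos x hx y hy)).differentiableAt
  · intro x hx y hy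
    have := lineX (hd e (hpos x hx y hy))
    rwa [fderiv_fderiv_apply (hv.analytic _ (hpos x hx y hy))] at this
  · intro x hx y hy
    exact lineY (hv.analytic _ (hpos x hx y hy)).differentiableAt
  · intro x hx y hy
    have := lineY (hd (e * Complex.I) (hpos x hx y hy))
    rwa [fderiv_fderiv_apply (hv.analytic _ (hpos x hx y hy))] at this
  · intro x hx y hy
    refine (Complex.abs_re_le_norm _).trans ?_
    rw [norm_mul, hc, one_mul]
    exact hM _ (hbox x hx y hy).1 (hbox x hx y hy).2
  · intro x hx y hy
    have e1 : fderiv ℝ (fderiv ℝ v) (P x y) e e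
        + fderiv ℝ (fderiv ℝ v) (P x y) (e * Complex.I) (e * Complex.I)
        = -(lam * v (P x y)) / ((P x y).im : ℂ) ^ 2 := by
      rw [← hv.fderiv_fderiv_add (hpos x hx y hy)]
      rcases he with rfl | rfl
      · simp
      · simp [add_comm]
    rw [← Complex.add_re, ← mul_add, e1]
    refine (Complex.abs_re_le_norm _).trans_lt ?_
    rw [norm_mul, hc, one_mul, norm_div, norm_neg, norm_mul, norm_pow, Complex.norm_real,
      Real.norm_eq_abs, sq_abs]
    have hv1 := hM _ (hbox x hx y hy).1 (hbox x hx y hy).2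
    have h1 : 1 ≤ (P x y).im ^ 2 := one_le_pow₀ (him x hx y hy)
    calc ‖lam‖ * ‖v (P x y)‖ / (P x y).im ^ 2 ≤ ‖lam‖ * ‖v (P x y)‖ :=
          div_le_self (by positivity) h1
      _ ≤ ‖lam‖ * M := by gcongr
      _ < (‖lam‖ + 1) * M := by linarith

/-- Interior gradient estimate for eigenfunctions of the hyperbolic Laplacian. -/
theorem IsLaplaceEigen.norm_fderiv_le {lam : ℂ} {v : ℂ → ℂ} (hv : IsLaplaceEigen lam v)
    {z₀ : ℂ} (hz₀ : 2 ≤ z₀.im) {M : ℝ} (hM0 : 0 < M)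
    (hM : ∀ z : ℂ, |z.re - z₀.re| ≤ 1 → |z.im - z₀.im| ≤ 1 → ‖v z‖ ≤ M) :
    ‖fderiv ℝ v z₀‖ ≤ (10 + 2 * ‖lam‖) * M := by
  have hB {e : ℂ} (he : e = 1 ∨ e = Complex.I) :
      ‖fderiv ℝ v z₀ e‖ ≤ (5 + ‖lam‖) * M := by
    have h1 := hv.norm_fderiv_apply_le hz₀ hM0 hM he (c := 1) (by simp)
    have h2 := hv.norm_fderiv_apply_le hz₀ hM0 hM he (c := -1) (by simp)
    have h3 := hv.norm_fderiv_apply_le hz₀ hM0 hM he (c := Complex.I) (by simp)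
    have h4 := hv.norm_fderiv_apply_le hz₀ hM0 hM he (c := -Complex.I) (by simp)
    simp at h1 h2 h3 h4
    refine (Complex.norm_le_abs_re_add_abs_im _).trans ?_
    have a1 : |(fderiv ℝ v z₀ e).re| ≤ 2 * M + (‖lam‖ + 1) * M / 2 :=
      abs_le.2 ⟨by linarith, by linarith⟩
    have a2 : |(fderiv ℝ v z₀ e).im| ≤ 2 * M + (‖lam‖ + 1) * M / 2 :=
      abs_le.2 ⟨by linarith, by linarith⟩
    linarith
  refine ContinuousLinearMap.opNorm_le_bound _ (by positivity) fun h => ?_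
  have hh : h = h.re • (1 : ℂ) + h.im • Complex.I := by simp [Complex.re_add_im]
  calc ‖fderiv ℝ v z₀ h‖ = ‖h.re • fderiv ℝ v z₀ 1 + h.im • fderiv ℝ v z₀ Complex.I‖ := by
        conv_lhs => rw [hh, map_add, map_smul, map_smul]
    _ ≤ |h.re| * ‖fderiv ℝ v z₀ 1‖ + |h.im| * ‖fderiv ℝ v z₀ Complex.I‖ := by
        refine (norm_add_le _ _).trans (le_of_eq ?_)
        rw [norm_smul, norm_smul, Real.norm_eq_abs, Real.norm_eq_abs]
    _ ≤ ‖h‖ * ((5 + ‖lam‖) * M) + ‖h‖ * ((5 + ‖lam‖) * M) := by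
        gcongr
        · exact Complex.abs_re_le_norm h
        · exact hB (Or.inl rfl)
        · exact Complex.abs_im_le_norm h
        · exact hB (Or.inr rfl)
    _ = (10 + 2 * ‖lam‖) * M * ‖h‖ := by ring

/-- The Green form `η(v, w) = (w ∂_y v - v ∂_y w) dx + (v ∂_x w - w ∂_x v) dy`, written without
coordinates. -/
def greenForm (v w : ℂ → ℂ) (z : ℂ) : ℂ →L[ℝ] ℂ :=
  w z • (fderiv ℝ v z ∘L (Complex.I • ContinuousLinearMap.id ℝ ℂ))
    - v z • (fderiv ℝ w z ∘L (Complex.I • ContinuousLinearMap.id ℝ ℂ))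

theorem greenForm_apply (v w : ℂ → ℂ) (z h : ℂ) :
    greenForm v w z h = w z * fderiv ℝ v z (Complex.I * h) - v z * fderiv ℝ w z (Complex.I * h) := by
  simp [greenForm]

theorem Complex.clm_apply_eq {E : Type*} [NormedAddCommGroup E] [NormedSpace ℝ E] (L : ℂ →L[ℝ] E)
    (h : ℂ) : L h = h.re • L 1 + h.im • L Complex.I := by
  conv_lhs => rw [show h = h.re • (1 : ℂ) + h.im • Complex.I by simp [Complex.re_add_im]]
  rw [map_add, map_smul, map_smul]

theorem norm_greenForm_le (v w : ℂ → ℂ) (z : ℂ) :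
    ‖greenForm v w z‖ ≤ ‖w z‖ * ‖fderiv ℝ v z‖ + ‖v z‖ * ‖fderiv ℝ w z‖ := by
  refine ContinuousLinearMap.opNorm_le_bound _ (by positivity) fun h => ?_
  rw [greenForm_apply]
  refine (norm_sub_le _ _).trans ?_
  rw [norm_mul, norm_mul]
  have h1 := (fderiv ℝ v z).le_opNorm (Complex.I * h)
  have h2 := (fderiv ℝ w z).le_opNorm (Complex.I * h)
  rw [norm_mul, Complex.norm_I, one_mul] at h1 h2
  calc _ ≤ ‖w z‖ * (‖fderiv ℝ v z‖ * ‖h‖) + ‖v z‖ * (‖fderiv ℝ w z‖ * ‖h‖) := by gcongr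
    _ = _ := by ring

theorem greenForm_const_mul_right (v w : ℂ → ℂ) (c : ℂ) {z : ℂ} (hw : DifferentiableAt ℝ w z) :
    greenForm v (fun z => c * w z) z = c • greenForm v w z := by
  ext1 h
  simp only [greenForm_apply, smul_apply, fderiv_const_mul hw, smul_eq_mul]
  ring

theorem greenForm_const_mul_left (v w : ℂ → ℂ) (c : ℂ) {z : ℂ} (hv : DifferentiableAt ℝ v z) :
    greenForm (fun z => c * v z) w z = c • greenForm v w z := by
  ext1 h
  simp only [greenForm_apply, smul_apply, fderiv_const_mul hv, smul_eq_mul]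
  ring

theorem greenForm_congr {v v' w w' : ℂ → ℂ} {z : ℂ} (hv : v =ᶠ[nhds z] v')
    (hw : w =ᶠ[nhds z] w') : greenForm v w z = greenForm v' w' z := by
  rw [greenForm, greenForm, hv.fderiv_eq, hw.fderiv_eq, hv.eq_of_nhds, hw.eq_of_nhds]

theorem differentiableAt_greenForm_apply {v w : ℂ → ℂ} {z : ℂ} (hv : AnalyticAt ℝ v z)
    (hw : AnalyticAt ℝ w z) (h : ℂ) : DifferentiableAt ℝ (fun z => greenForm v w z h) z := by
  simp only [greenForm_apply]
  have h1 := hv.fderiv.differentiableAt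
  have h2 := hw.fderiv.differentiableAt
  have h3 := hv.differentiableAt
  have h4 := hw.differentiableAt
  fun_prop

theorem hasFDerivAt_primitive_comp {v w F g : ℂ → ℂ} {z g' : ℂ} (hg : HasDerivAt g g' z)
    (hv : DifferentiableAt ℝ v (g z)) (hw : DifferentiableAt ℝ w (g z))
    (hF : HasFDerivAt F (greenForm v w (g z)) (g z)) :
    HasFDerivAt (fun z => F (g z)) (greenForm (fun z => v (g z)) (fun z => w (g z)) z) z := by
  have hgR : HasFDerivAt g (g' • ContinuousLinearMap.id ℝ ℂ) z := by
    refine (hg.hasFDerivAt.restrictScalars ℝ).congr_fderiv ?_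
    ext
    simp [mul_comm]
  have h1 := hv.hasFDerivAt.comp z hgR
  have h2 := hw.hasFDerivAt.comp z hgR
  have h3 := hF.comp z hgR
  refine h3.congr_fderiv ?_
  ext1 h
  have e1 : fderiv ℝ (fun z => v (g z)) z = _ := h1.fderiv
  have e2 : fderiv ℝ (fun z => w (g z)) z = _ := h2.fderiv
  simp only [greenForm_apply, e1, e2, ContinuousLinearMap.comp_apply,
    smul_apply, ContinuousLinearMap.id_apply, smul_eq_mul]
  rw [mul_left_comm g' Complex.I h]

/-- The Green form of two eigenfunctions with the same eigenvalue is exact. -/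
theorem IsLaplaceEigen.exists_primitive {lam : ℂ} {v w : ℂ → ℂ} (hv : IsLaplaceEigen lam v)
    (hw : IsLaplaceEigen lam w) :
    ∃ F : ℂ → ℂ, ∀ z : ℂ, 0 < z.im → HasFDerivAt F (greenForm v w z) z := by
  have hconv : Convex ℝ {z : ℂ | 0 < z.im} := convex_halfSpace_im_gt 0
  have hd : DifferentiableOn ℝ (greenForm v w) {z : ℂ | 0 < z.im} := by
    intro z hz
    have h1 := (hv.analytic z hz).fderiv.differentiableAt
    have h2 := (hw.analytic z hz).fderiv.differentiableAt
    have h3 := (hv.analytic z hz).differentiableAt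
    have h4 := (hw.analytic z hz).differentiableAt
    refine DifferentiableAt.differentiableWithinAt ?_
    exact (h4.smul (h1.clm_comp (differentiableAt_const _))).sub
      (h3.smul (h2.clm_comp (differentiableAt_const _)))
  refine hconv.exists_forall_hasFDerivAt_of_fderiv_symmetric isOpen_setOf_im_pos hd ?_
  intro z hz
  have hdz : DifferentiableAt ℝ (greenForm v w) z :=
    hd.differentiableAt (isOpen_setOf_im_pos.mem_nhds hz)
  have main (x y : ℂ) : fderiv ℝ (greenForm v w) z x y
      = (fderiv ℝ w z x * fderiv ℝ v z (Complex.I * y)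
          + w z * fderiv ℝ (fderiv ℝ v) z x (Complex.I * y))
        - (fderiv ℝ v z x * fderiv ℝ w z (Complex.I * y)
          + v z * fderiv ℝ (fderiv ℝ w) z x (Complex.I * y)) := by
    have e1 : fderiv ℝ (fun z => greenForm v w z y) z x = fderiv ℝ (greenForm v w) z x y := by
      rw [(hdz.hasFDerivAt.clm_apply (hasFDerivAt_const y z)).fderiv]
      simp
    rw [← e1]
    simp only [greenForm_apply]
    have h1 := (hv.analytic z hz).fderiv.differentiableAt.clm_apply
      (differentiableAt_const (Complex.I * y))
    have h2 := (hw.analytic z hz).fderiv.differentiableAt.clm_apply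
      (differentiableAt_const (Complex.I * y))
    have h3 := (hv.analytic z hz).differentiableAt
    have h4 := (hw.analytic z hz).differentiableAt
    have e2 : fderiv ℝ (fun z => w z * fderiv ℝ v z (Complex.I * y)
        - v z * fderiv ℝ w z (Complex.I * y)) z = _ :=
      ((h4.hasFDerivAt.mul h1.hasFDerivAt).sub (h3.hasFDerivAt.mul h2.hasFDerivAt)).fderiv
    rw [e2]
    simp [fderiv_fderiv_apply (hv.analytic z hz), fderiv_fderiv_apply (hw.analytic z hz)]
    ring
  intro x y
  rw [main, main]
  have hV := hv.fderiv_fderiv_add hz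
  have hW := hw.fderiv_fderiv_add hz
  have hVW : w z * (fderiv ℝ (fderiv ℝ v) z 1 1
        + fderiv ℝ (fderiv ℝ v) z Complex.I Complex.I)
      = v z * (fderiv ℝ (fderiv ℝ w) z 1 1
        + fderiv ℝ (fderiv ℝ w) z Complex.I Complex.I) := by
    rw [hV, hW]; ring
  rw [Complex.clm_apply_eq (fderiv ℝ v z) x, Complex.clm_apply_eq (fderiv ℝ w z) x,
    Complex.clm_apply_eq (fderiv ℝ v z) y, Complex.clm_apply_eq (fderiv ℝ w z) y,
    Complex.clm_apply_eq (fderiv ℝ v z) (Complex.I * x),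
    Complex.clm_apply_eq (fderiv ℝ w z) (Complex.I * x),
    Complex.clm_apply_eq (fderiv ℝ v z) (Complex.I * y),
    Complex.clm_apply_eq (fderiv ℝ w z) (Complex.I * y),
    Complex.clm_apply_eq (fderiv ℝ (fderiv ℝ v) z) x,
    Complex.clm_apply_eq (fderiv ℝ (fderiv ℝ v) z) y,
    Complex.clm_apply_eq (fderiv ℝ (fderiv ℝ w) z) x,
    Complex.clm_apply_eq (fderiv ℝ (fderiv ℝ w) z) y]
  simp only [add_apply, smul_apply]
  rw [Complex.clm_apply_eq (fderiv ℝ (fderiv ℝ v) z 1) (Complex.I * x),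
    Complex.clm_apply_eq (fderiv ℝ (fderiv ℝ v) z 1) (Complex.I * y),
    Complex.clm_apply_eq (fderiv ℝ (fderiv ℝ v) z Complex.I) (Complex.I * x),
    Complex.clm_apply_eq (fderiv ℝ (fderiv ℝ v) z Complex.I) (Complex.I * y),
    Complex.clm_apply_eq (fderiv ℝ (fderiv ℝ w) z 1) (Complex.I * x),
    Complex.clm_apply_eq (fderiv ℝ (fderiv ℝ w) z 1) (Complex.I * y),
    Complex.clm_apply_eq (fderiv ℝ (fderiv ℝ w) z Complex.I) (Complex.I * x),
    Complex.clm_apply_eq (fderiv ℝ (fderiv ℝ w) z Complex.I) (Complex.I * y)]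
  simp
  linear_combination ((x.im : ℂ) * y.re - x.re * y.im) * hVW

theorem Rpow_eq_exp (s : ℂ) (ζ : ℝ) {z : ℂ} (hz : 0 < z.im) :
    Rpow s ζ z = Complex.exp (s *
      ((Real.log z.im - Real.log ((z.re - ζ) ^ 2 + z.im ^ 2) : ℝ) : ℂ)) := by
  have h1 : 0 < (z.re - ζ) ^ 2 + z.im ^ 2 := by positivity
  have h2 : 0 < Rfun ζ z := div_pos hz h1
  rw [Rpow, Complex.cpow_def_of_ne_zero (by exact_mod_cast h2.ne'), ← Complex.ofReal_log h2.le,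
    Rfun, Real.log_div hz.ne' h1.ne', mul_comm]

theorem hasDerivAt_exp_mul_ofReal {L : ℝ → ℝ} {L' t : ℝ} (s : ℂ) (h : HasDerivAt L L' t) :
    HasDerivAt (fun t => Complex.exp (s * (L t : ℂ)))
      (s * L' * Complex.exp (s * (L t : ℂ))) t := by
  have := (h.ofReal_comp.const_mul s).cexp
  exact this.congr_deriv (by ring)

theorem hasDerivAt_mul_exp_mul_ofReal {L L' : ℝ → ℝ} {L'' t : ℝ} (s : ℂ) (h : HasDerivAt L (L' t) t)
    (h' : HasDerivAt L' L'' t) :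
    HasDerivAt (fun t => s * (L' t : ℂ) * Complex.exp (s * (L t : ℂ)))
      ((s * L'' + s ^ 2 * (L' t : ℂ) ^ 2) * Complex.exp (s * (L t : ℂ))) t := by
  have := (h'.ofReal_comp.const_mul s).mul (hasDerivAt_exp_mul_ofReal s h)
  exact this.congr_deriv (by ring)

theorem isLaplaceEigen_Rpow (s : ℂ) (ζ : ℝ) : IsLaplaceEigen (s * (1 - s)) (Rpow s ζ) := by
  have hev {z : ℂ} (hz : 0 < z.im) : Rpow s ζ =ᶠ[nhds z] fun z => Complex.exp (s *
      ((Real.log z.im - Real.log ((z.re - ζ) ^ 2 + z.im ^ 2) : ℝ) : ℂ)) :=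
    Filter.eventually_of_mem (isOpen_setOf_im_pos.mem_nhds hz) fun w hw => Rpow_eq_exp s ζ hw
  have hN {z : ℂ} (hz : 0 < z.im) : 0 < (z.re - ζ) ^ 2 + z.im ^ 2 := by positivity
  refine ⟨fun z hz => ?_, fun z hz => ?_⟩
  · have him : AnalyticAt ℝ (fun z : ℂ => z.im) z := Complex.imCLM.analyticAt z
    have hre : AnalyticAt ℝ (fun z : ℂ => z.re) z := Complex.reCLM.analyticAt z
    refine AnalyticAt.congr ?_ (hev hz).symm
    have hNa : AnalyticAt ℝ (fun z : ℂ => (z.re - ζ) ^ 2 + z.im ^ 2) z :=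
      ((hre.sub analyticAt_const).pow 2).add (him.pow 2)
    have h1 : AnalyticAt ℝ (fun z : ℂ =>
        Real.log z.im - Real.log ((z.re - ζ) ^ 2 + z.im ^ 2)) z := by
      have hlog {g : ℂ → ℝ} (hg : AnalyticAt ℝ g z) (h : 0 < g z) :
          AnalyticAt ℝ (fun z => Real.log (g z)) z :=
        (_root_.analyticAt_log h).comp hg
      exact (hlog him hz).sub (hlog hNa (hN hz))
    have h2 : AnalyticAt ℝ (fun z : ℂ =>
        ((Real.log z.im - Real.log ((z.re - ζ) ^ 2 + z.im ^ 2) : ℝ) : ℂ)) z :=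
      (Complex.ofRealCLM.analyticAt _).comp h1
    exact (analyticAt_cexp.restrictScalars).comp (analyticAt_const.mul h2)
  · set E : ℂ → ℂ := fun z => Complex.exp (s *
      ((Real.log z.im - Real.log ((z.re - ζ) ^ 2 + z.im ^ 2) : ℝ) : ℂ)) with hE
    have dNx (x y : ℝ) : HasDerivAt (fun t : ℝ => (t - ζ) ^ 2 + y ^ 2) (2 * (x - ζ)) x := by
      have := (((hasDerivAt_id x).sub_const ζ).pow 2).add_const (y ^ 2)
      exact this.congr_deriv (by simp)
    have dNy (x y : ℝ) : HasDerivAt (fun t : ℝ => (x - ζ) ^ 2 + t ^ 2) (2 * y) y := by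
      have := ((hasDerivAt_id y).pow 2).const_add ((x - ζ) ^ 2)
      exact this.congr_deriv (by simp)
    have dLx {x y : ℝ} (h : (x - ζ) ^ 2 + y ^ 2 ≠ 0) :
        HasDerivAt (fun t => Real.log y - Real.log ((t - ζ) ^ 2 + y ^ 2))
          (-(2 * (x - ζ)) / ((x - ζ) ^ 2 + y ^ 2)) x :=
      (((dNx x y).log h).const_sub (Real.log y)).congr_deriv (by ring)
    have dLy {x y : ℝ} (hy : y ≠ 0) (h : (x - ζ) ^ 2 + y ^ 2 ≠ 0) :
        HasDerivAt (fun t => Real.log t - Real.log ((x - ζ) ^ 2 + t ^ 2))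
          (1 / y - 2 * y / ((x - ζ) ^ 2 + y ^ 2)) y :=
      (((hasDerivAt_id y).log hy).sub ((dNy x y).log h)).congr_deriv (by simp)
    have dLxx {x y : ℝ} (h : (x - ζ) ^ 2 + y ^ 2 ≠ 0) :
        HasDerivAt (fun t => -(2 * (t - ζ)) / ((t - ζ) ^ 2 + y ^ 2))
          ((4 * (x - ζ) ^ 2 - 2 * ((x - ζ) ^ 2 + y ^ 2)) / ((x - ζ) ^ 2 + y ^ 2) ^ 2) x :=
      (((((hasDerivAt_id x).sub_const ζ).const_mul 2).neg).div (dNx x y) h).congr_deriv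
        (by simp; ring)
    have dLyy {x y : ℝ} (hy : y ≠ 0) (h : (x - ζ) ^ 2 + y ^ 2 ≠ 0) :
        HasDerivAt (fun t => 1 / t - 2 * t / ((x - ζ) ^ 2 + t ^ 2))
          (-1 / y ^ 2 - (2 * ((x - ζ) ^ 2 + y ^ 2) - 4 * y ^ 2) / ((x - ζ) ^ 2 + y ^ 2) ^ 2) y :=
      (((hasDerivAt_const y (1 : ℝ)).div (hasDerivAt_id y) hy).sub
        (((hasDerivAt_id y).const_mul 2).div (dNy x y) h)).congr_deriv (by simp; ring)
    have px {z : ℂ} (hz : 0 < z.im) : pdx (Rpow s ζ) z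
        = s * ((-(2 * (z.re - ζ)) / ((z.re - ζ) ^ 2 + z.im ^ 2) : ℝ) : ℂ) * E z := by
      rw [pdx_congr (hev hz), pdx]
      simpa [hE] using (hasDerivAt_exp_mul_ofReal s (dLx (hN hz).ne')).deriv
    have py {z : ℂ} (hz : 0 < z.im) : pdy (Rpow s ζ) z
        = s * ((1 / z.im - 2 * z.im / ((z.re - ζ) ^ 2 + z.im ^ 2) : ℝ) : ℂ) * E z := by
      rw [pdy_congr (hev hz), pdy]
      simpa [hE] using (hasDerivAt_exp_mul_ofReal s (dLy hz.ne' (hN hz).ne')).deriv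
    have pxx : pdx (pdx (Rpow s ζ)) z
        = (s * (((4 * (z.re - ζ) ^ 2 - 2 * ((z.re - ζ) ^ 2 + z.im ^ 2))
            / ((z.re - ζ) ^ 2 + z.im ^ 2) ^ 2 : ℝ) : ℂ)
          + s ^ 2 * ((-(2 * (z.re - ζ)) / ((z.re - ζ) ^ 2 + z.im ^ 2) : ℝ) : ℂ) ^ 2) * E z := by
      rw [pdx_congr (Filter.eventually_of_mem (isOpen_setOf_im_pos.mem_nhds hz)
        fun w hw => px hw), pdx]
      simpa [hE] using (hasDerivAt_mul_exp_mul_ofReal s (dLx (hN hz).ne') (dLxx (hN hz).ne')).deriv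
    have pyy : pdy (pdy (Rpow s ζ)) z
        = (s * ((-1 / z.im ^ 2 - (2 * ((z.re - ζ) ^ 2 + z.im ^ 2) - 4 * z.im ^ 2)
            / ((z.re - ζ) ^ 2 + z.im ^ 2) ^ 2 : ℝ) : ℂ)
          + s ^ 2 * ((1 / z.im - 2 * z.im / ((z.re - ζ) ^ 2 + z.im ^ 2) : ℝ) : ℂ) ^ 2) * E z := by
      rw [pdy_congr (Filter.eventually_of_mem (isOpen_setOf_im_pos.mem_nhds hz)
        fun w hw => py hw), pdy]
      simpa [hE] using (hasDerivAt_mul_exp_mul_ofReal s (dLy hz.ne' (hN hz).ne')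
        (dLyy hz.ne' (hN hz).ne')).deriv
    rw [laplace, pxx, pyy, Rpow_eq_exp s ζ hz, hE]
    have h0 : (z.im : ℂ) ≠ 0 := by exact_mod_cast hz.ne'
    have h1 : ((z.re : ℂ) - ζ) ^ 2 + (z.im : ℂ) ^ 2 ≠ 0 := by exact_mod_cast (hN hz).ne'
    push_cast
    generalize Complex.exp _ = e
    field_simp
    ring

theorem Real.rpow_le_two_rpow_abs_mul {y t : ℝ} (hy : 0 < y) (h1 : y / 2 ≤ t) (h2 : t ≤ 2 * y)
    (C : ℝ) : t ^ C ≤ 2 ^ |C| * y ^ C := by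
  have ht : 0 < t := by linarith
  rcases le_or_gt 0 C with hC | hC
  · rw [abs_of_nonneg hC, ← Real.mul_rpow zero_le_two hy.le]
    exact Real.rpow_le_rpow ht.le h2 hC
  · have h3 : (2 : ℝ) ^ |C| * y ^ C = (y / 2) ^ C := by
      rw [abs_of_neg hC, Real.div_rpow hy.le zero_le_two, Real.rpow_neg zero_le_two]
      field_simp
    rw [h3]
    exact Real.rpow_le_rpow_of_nonpos (by positivity) h1 hC.le

/-- In vertical strips, polynomial growth or decay of an eigenfunction at `i∞` is inherited by its
gradient. -/
theorem IsLaplaceEigen.exists_fderiv_bound {lam : ℂ} {v : ℂ → ℂ} (hv : IsLaplaceEigen lam v)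
    {X C K T : ℝ} (h : ∀ z : ℂ, 0 < z.im → |z.re| ≤ X + 1 → T ≤ z.im → ‖v z‖ ≤ K * z.im ^ C) :
    ∃ K' T' : ℝ, 0 ≤ K' ∧ 2 ≤ T' ∧ ∀ z : ℂ, |z.re| ≤ X → T' ≤ z.im →
      ‖v z‖ ≤ K' * z.im ^ C ∧ ‖fderiv ℝ v z‖ ≤ K' * z.im ^ C := by
  set K₁ : ℝ := max K 1 * 2 ^ |C| with hK₁
  have hK₁0 : 0 < K₁ := by positivity
  refine ⟨(10 + 2 * ‖lam‖) * K₁, max T 1 + 1, by positivity, by linarith [le_max_right T 1],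
    fun z hx hz => ?_⟩
  have hz2 : 2 ≤ z.im := by linarith [le_max_right T 1]
  have hz0 : 0 < z.im := by linarith
  have hM0 : 0 < K₁ * z.im ^ C := by positivity
  have hM : ∀ w : ℂ, |w.re - z.re| ≤ 1 → |w.im - z.im| ≤ 1 → ‖v w‖ ≤ K₁ * z.im ^ C := by
    intro w hw1 hw2
    have h3 := abs_le.1 hw2
    have hw0 : 0 < w.im := by linarith
    have h4 : |w.re| ≤ X + 1 := by
      have := abs_add_le (w.re - z.re) z.re
      rw [sub_add_cancel] at this
      linarith
    calc ‖v w‖ ≤ K * w.im ^ C := h w hw0 h4 (by linarith [le_max_left T 1, h3.1])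
      _ ≤ max K 1 * (2 ^ |C| * z.im ^ C) := by
        gcongr
        · exact le_max_left _ _
        · exact Real.rpow_le_two_rpow_abs_mul hz0 (by linarith) (by linarith) C
      _ = K₁ * z.im ^ C := by rw [hK₁]; ring
  constructor
  · calc ‖v z‖ ≤ 1 * (K₁ * z.im ^ C) := by
          rw [one_mul]; exact hM z (by simp) (by simp)
      _ ≤ (10 + 2 * ‖lam‖) * (K₁ * z.im ^ C) := by
          gcongr
          linarith [norm_nonneg lam]
      _ = _ := by ring
  · rw [mul_assoc]
    exact hv.norm_fderiv_le hz2 hM0 hM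

theorem norm_Rpow_le (s : ℂ) (ζ X : ℝ) {z : ℂ} (hx : |z.re| ≤ X) (hz : 1 ≤ z.im) :
    ‖Rpow s ζ z‖ ≤ ((X + |ζ|) ^ 2 + 1) ^ |s.re| * z.im ^ |s.re| := by
  have hz0 : 0 < z.im := by linarith
  have hN : 0 < (z.re - ζ) ^ 2 + z.im ^ 2 := by positivity
  have hR : 0 < Rfun ζ z := div_pos hz0 hN
  have hR1 : Rfun ζ z ≤ 1 := by
    rw [Rfun, div_le_one hN]
    nlinarith [sq_nonneg (z.re - ζ)]
  have hRinv : (Rfun ζ z)⁻¹ ≤ ((X + |ζ|) ^ 2 + 1) * z.im := by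
    rw [Rfun, inv_div, div_le_iff₀ hz0]
    have h1 : (z.re - ζ) ^ 2 ≤ (X + |ζ|) ^ 2 := by
      rw [← sq_abs (z.re - ζ)]
      gcongr
      exact (abs_sub _ _).trans (by linarith)
    have h2 : (X + |ζ|) ^ 2 * 1 ≤ (X + |ζ|) ^ 2 * z.im ^ 2 := by
      gcongr
      exact one_le_pow₀ hz
    linarith
  rw [Rpow, Complex.norm_cpow_eq_rpow_re_of_pos hR]
  calc Rfun ζ z ^ s.re ≤ Rfun ζ z ^ (-|s.re|) :=
        Real.rpow_le_rpow_of_exponent_ge hR hR1 (neg_abs_le _)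
    _ = (Rfun ζ z)⁻¹ ^ |s.re| := by rw [Real.rpow_neg hR.le, Real.inv_rpow hR.le]
    _ ≤ (((X + |ζ|) ^ 2 + 1) * z.im) ^ |s.re| := by gcongr
    _ = _ := Real.mul_rpow (by positivity) hz0.le

/-- Eigenfunctions of the hyperbolic Laplacian that decay rapidly at `i∞`. -/
structure IsCuspidalEigen (lam : ℂ) (v : ℂ → ℂ) : Prop extends IsLaplaceEigen lam v where
  decay : ∀ C : ℝ, ∃ K T : ℝ, ∀ z : ℂ, 0 < z.im → T ≤ z.im → ‖v z‖ ≤ K * z.im ^ C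

theorem IsCuspidalEigen.exists_greenForm_bound {s : ℂ} {v : ℂ → ℂ}
    (hv : IsCuspidalEigen (s * (1 - s)) v) (ζ X : ℝ) :
    ∃ K T : ℝ, 0 ≤ K ∧ 2 ≤ T ∧ ∀ z : ℂ, |z.re| ≤ X → T ≤ z.im →
      ‖greenForm v (Rpow s ζ) z‖ ≤ K / z.im ^ 2 := by
  obtain ⟨K₀, T₀, h₀⟩ := hv.decay (-2 - |s.re|)
  obtain ⟨K₁, T₁, hK₁, hT₁, h₁⟩ := hv.toIsLaplaceEigen.exists_fderiv_bound (X := X)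
    (fun z hz _ hT => h₀ z hz hT)
  obtain ⟨K₂, T₂, hK₂, hT₂, h₂⟩ := (isLaplaceEigen_Rpow s ζ).exists_fderiv_bound (X := X) (T := 1)
    (fun z _ hx hT => norm_Rpow_le s ζ (X + 1) hx hT)
  refine ⟨2 * (K₁ * K₂), max T₁ T₂, by positivity, le_max_of_le_left hT₁, fun z hx hT => ?_⟩
  obtain ⟨a1, a2⟩ := h₁ z hx ((le_max_left _ _).trans hT)
  obtain ⟨b1, b2⟩ := h₂ z hx ((le_max_right _ _).trans hT)
  have hz : 0 < z.im := by linarith [le_max_left T₁ T₂]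
  have e : z.im ^ (-2 - |s.re|) * z.im ^ |s.re| = (z.im ^ 2)⁻¹ := by
    rw [← Real.rpow_add hz, sub_add_cancel, Real.rpow_neg hz.le]
    norm_num
  calc ‖greenForm v (Rpow s ζ) z‖
      ≤ ‖Rpow s ζ z‖ * ‖fderiv ℝ v z‖ + ‖v z‖ * ‖fderiv ℝ (Rpow s ζ) z‖ := norm_greenForm_le _ _ _
    _ ≤ (K₂ * z.im ^ |s.re|) * (K₁ * z.im ^ (-2 - |s.re|))
        + (K₁ * z.im ^ (-2 - |s.re|)) * (K₂ * z.im ^ |s.re|) := by gcongr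
    _ = 2 * (K₁ * K₂) * (z.im ^ (-2 - |s.re|) * z.im ^ |s.re|) := by ring
    _ = _ := by rw [e]; rfl

open Set in
theorem IsLaplaceEigen.continuousOn_greenForm_vertical {lam lam' : ℂ} {v w : ℂ → ℂ}
    (hv : IsLaplaceEigen lam v) (hw : IsLaplaceEigen lam' w) :
    ContinuousOn (fun y : ℝ => greenForm v w (y * Complex.I) Complex.I) (Ioi 0) := by
  have h : ContinuousOn (fun z => greenForm v w z Complex.I) {z : ℂ | 0 < z.im} := fun z hz =>
    (differentiableAt_greenForm_apply (hv.analytic z hz) (hw.analytic z hz)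
      Complex.I).continuousAt.continuousWithinAt
  exact h.comp (f := fun y : ℝ => (y : ℂ) * Complex.I) (by fun_prop) fun y hy => by simpa using hy

open Set in
theorem IsCuspidalEigen.exists_integrableOn_Ioi {s : ℂ} {v : ℂ → ℂ}
    (hv : IsCuspidalEigen (s * (1 - s)) v) (ζ : ℝ) :
    ∃ T : ℝ, ∀ T' ≥ T, 0 < T' ∧ IntegrableOn
      (fun y : ℝ => greenForm v (Rpow s ζ) (y * Complex.I) Complex.I) (Ioi T') := by
  obtain ⟨K, T, hK, hT, h⟩ := hv.exists_greenForm_bound ζ 0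
  refine ⟨T, fun T' hT' => ⟨by linarith, ?_⟩⟩
  have hint : IntegrableOn (fun y : ℝ => K * y ^ (-2 : ℝ)) (Ioi T') :=
    (integrableOn_Ioi_rpow_of_lt (by norm_num) (by linarith)).const_mul K
  refine Integrable.mono' hint ?_ ?_
  · exact ((hv.continuousOn_greenForm_vertical (isLaplaceEigen_Rpow s ζ)).mono
      (Ioi_subset_Ioi (by linarith))).aestronglyMeasurable measurableSet_Ioi
  · refine (ae_restrict_iff' measurableSet_Ioi).2 (Filter.Eventually.of_forall fun y hy => ?_)
    have hy' : T' < y := hy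
    have hb := h (y * Complex.I) (by simp) (by simp; linarith)
    refine ((greenForm v (Rpow s ζ) (y * Complex.I)).le_opNorm _).trans ?_
    rw [Complex.norm_I, mul_one]
    refine hb.trans (le_of_eq ?_)
    rw [Real.rpow_neg (by linarith)]
    simp [div_eq_mul_inv]

open Set Filter Topology in
/-- A primitive of the Green form has a limit at `i∞`, the same along all vertical lines. -/
theorem IsCuspidalEigen.exists_tendsto_primitive {s : ℂ} {v F : ℂ → ℂ} {ζ : ℝ}
    (hv : IsCuspidalEigen (s * (1 - s)) v)
    (hF : ∀ z : ℂ, 0 < z.im → HasFDerivAt F (greenForm v (Rpow s ζ) z) z) :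
    ∃ L : ℂ, ∀ x : ℝ, Tendsto (fun y : ℝ => F (x + y * Complex.I)) atTop (𝓝 L) := by
  obtain ⟨T, hT⟩ := hv.exists_integrableOn_Ioi ζ
  obtain ⟨hT0, hint⟩ := hT T le_rfl
  have hline : ∀ y ∈ Ioi T, HasDerivAt (fun y : ℝ => F (y * Complex.I))
      (greenForm v (Rpow s ζ) (y * Complex.I) Complex.I) y := by
    intro y hy
    have h1 : HasDerivAt (fun y : ℝ => (y : ℂ) * Complex.I) Complex.I y := by
      simpa using (Complex.ofRealCLM.hasDerivAt (x := y)).mul_const Complex.I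
    exact (hF (y * Complex.I) (by simpa using hT0.trans hy)).comp_hasDerivAt y h1
  have hlim := tendsto_limUnder_of_hasDerivAt_of_integrableOn_Ioi hline hint
  refine ⟨limUnder atTop (fun y : ℝ => F (y * Complex.I)), fun x => ?_⟩
  obtain ⟨K, T₁, hK, hT₁, hb⟩ := hv.exists_greenForm_bound ζ |x|
  have hdiff : Tendsto (fun y : ℝ => F (x + y * Complex.I) - F (y * Complex.I)) atTop (𝓝 0) := by
    have h0 : Tendsto (fun y : ℝ => K / y ^ 2 * |x|) atTop (𝓝 0) := by
      have : Tendsto (fun y : ℝ => K / y ^ 2) atTop (𝓝 0) :=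
        tendsto_const_nhds.div_atTop (tendsto_pow_atTop two_ne_zero)
      simpa using this.mul_const |x|
    refine squeeze_zero_norm' ?_ h0
    filter_upwards [eventually_ge_atTop T₁] with y hy
    have hd : ∀ t : ℝ, HasDerivAt (fun t : ℝ => F (y * Complex.I + t * x))
        (greenForm v (Rpow s ζ) (y * Complex.I + t * x) x) t := by
      intro t
      have h1 : HasDerivAt (fun t : ℝ => (y : ℂ) * Complex.I + (t : ℂ) * x) (x : ℂ) t := by
        simpa using ((Complex.ofRealCLM.hasDerivAt (x := t)).mul_const (x : ℂ)).const_add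
          ((y : ℂ) * Complex.I)
      exact (hF _ (by simp; linarith)).comp_hasDerivAt t h1
    have := norm_image_sub_le_of_norm_deriv_le_segment_01' (C := K / y ^ 2 * |x|)
      (fun t _ => (hd t).hasDerivWithinAt) (fun t ht => ?_)
    · simpa [add_comm] using this
    · refine (ContinuousLinearMap.le_opNorm _ _).trans ?_
      rw [Complex.norm_real, Real.norm_eq_abs]
      gcongr
      have h2 := hb (y * Complex.I + t * x) (by
        simp [abs_mul, abs_of_nonneg ht.1]
        exact mul_le_of_le_one_left (abs_nonneg x) ht.2.le) (by simpa using hy)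
      simpa using h2
  simpa using hdiff.add hlim

theorem moeb_denom_ne_zero (g : SL2) {z : ℂ} (hz : 0 < z.im) :
    (g 1 0 : ℂ) * z + (g 1 1 : ℂ) ≠ 0 := by
  intro h
  have him := congrArg Complex.im h
  have hre := congrArg Complex.re h
  simp [hz.ne'] at him
  simp [him] at hre
  have hdet := g.det_coe
  rw [Matrix.det_fin_two] at hdet
  simp [him, hre] at hdet

theorem det_sl2 (g : SL2) : (g 0 0 : ℤ) * g 1 1 - g 0 1 * g 1 0 = 1 := by
  have hdet := g.det_coe
  rwa [Matrix.det_fin_two] at hdet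

theorem moeb_im (g : SL2) (z : ℂ) :
    (moeb g z).im = z.im / Complex.normSq ((g 1 0 : ℂ) * z + (g 1 1 : ℂ)) := by
  have hdet : (g 0 0 : ℝ) * g 1 1 - g 0 1 * g 1 0 = 1 := by exact_mod_cast det_sl2 g
  rw [moeb, Complex.div_im, ← sub_div]
  congr 1
  simp
  linear_combination z.im * hdet

theorem moeb_im_pos (g : SL2) {z : ℂ} (hz : 0 < z.im) : 0 < (moeb g z).im := by
  rw [moeb_im]
  exact div_pos hz (Complex.normSq_pos.2 (moeb_denom_ne_zero g hz))

theorem hasDerivAt_moeb (g : SL2) {z : ℂ} (hz : 0 < z.im) :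
    HasDerivAt (moeb g) (1 / ((g 1 0 : ℂ) * z + (g 1 1 : ℂ)) ^ 2) z := by
  have hdet : (g 0 0 : ℂ) * g 1 1 - g 0 1 * g 1 0 = 1 := by exact_mod_cast det_sl2 g
  have h1 : HasDerivAt (fun z : ℂ => (g 0 0 : ℂ) * z + (g 0 1 : ℂ)) (g 0 0 : ℂ) z := by
    simpa using ((hasDerivAt_id z).const_mul (g 0 0 : ℂ)).add_const (g 0 1 : ℂ)
  have h2 : HasDerivAt (fun z : ℂ => (g 1 0 : ℂ) * z + (g 1 1 : ℂ)) (g 1 0 : ℂ) z := by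
    simpa using ((hasDerivAt_id z).const_mul (g 1 0 : ℂ)).add_const (g 1 1 : ℂ)
  refine (h1.div h2 (moeb_denom_ne_zero g hz)).congr_deriv ?_
  congr 1
  linear_combination hdet

theorem Rfun_eq_normSq (ζ : ℝ) (z : ℂ) : Rfun ζ z = z.im / Complex.normSq (z - ζ) := by
  simp [Rfun, Complex.normSq_apply, sq]

theorem Rfun_moeb (g : SL2) {z : ℂ} (hz : 0 < z.im) {ζ ζ' : ℝ}
    (hd : (g 1 0 : ℝ) * ζ' + (g 1 1 : ℝ) ≠ 0)
    (hζ : ζ * ((g 1 0 : ℝ) * ζ' + (g 1 1 : ℝ)) = (g 0 0 : ℝ) * ζ' + (g 0 1 : ℝ)) :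
    Rfun ζ (moeb g z) = ((g 1 0 : ℝ) * ζ' + (g 1 1 : ℝ)) ^ 2 * Rfun ζ' z := by
  have hdet : (g 0 0 : ℂ) * g 1 1 - g 0 1 * g 1 0 = 1 := by exact_mod_cast det_sl2 g
  have hz0 := moeb_denom_ne_zero g hz
  have hd' : ((g 1 0 : ℂ) * ζ' + (g 1 1 : ℂ)) ≠ 0 := by exact_mod_cast hd
  have hζ' : (ζ : ℂ) * ((g 1 0 : ℂ) * ζ' + (g 1 1 : ℂ)) = (g 0 0 : ℂ) * ζ' + (g 0 1 : ℂ) := by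
    exact_mod_cast hζ
  have e : moeb g z - ζ = (z - ζ') /
      (((g 1 0 : ℂ) * z + (g 1 1 : ℂ)) * ((g 1 0 : ℂ) * ζ' + (g 1 1 : ℂ))) := by
    rw [eq_div_iff (mul_ne_zero hz0 hd'), moeb, sub_mul, ← mul_assoc, div_mul_cancel₀ _ hz0]
    linear_combination (z - ζ') * hdet - ((g 1 0 : ℂ) * z + (g 1 1 : ℂ)) * hζ'
  have e2 : Complex.normSq ((g 1 0 : ℂ) * ζ' + (g 1 1 : ℂ))
      = ((g 1 0 : ℝ) * ζ' + (g 1 1 : ℝ)) ^ 2 := by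
    simp [Complex.normSq_apply, sq]
  have h1 : Complex.normSq ((g 1 0 : ℂ) * z + (g 1 1 : ℂ)) ≠ 0 := by simpa using hz0
  have h2 : Complex.normSq (z - ζ') ≠ 0 := by
    rw [Ne, Complex.normSq_eq_zero]
    intro h
    have := congrArg Complex.im h
    simp at this
    exact hz.ne' this
  rw [Rfun_eq_normSq, Rfun_eq_normSq, e, moeb_im, Complex.normSq_div, Complex.normSq_mul, e2]
  field_simp

theorem Rpow_moeb (s : ℂ) (g : SL2) {z : ℂ} (hz : 0 < z.im) {ζ ζ' : ℝ}
    (hd : (g 1 0 : ℝ) * ζ' + (g 1 1 : ℝ) ≠ 0)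
    (hζ : ζ * ((g 1 0 : ℝ) * ζ' + (g 1 1 : ℝ)) = (g 0 0 : ℝ) * ζ' + (g 0 1 : ℝ)) :
    Rpow s ζ (moeb g z) =
      ((((g 1 0 : ℝ) * ζ' + (g 1 1 : ℝ)) ^ 2 : ℝ) : ℂ) ^ s * Rpow s ζ' z := by
  rw [Rpow, Rpow, Rfun_moeb g hz hd hζ, Complex.ofReal_mul]
  exact Complex.mul_cpow_ofReal_nonneg (sq_nonneg _) (div_nonneg hz.le (by positivity)) s

/-- Pulling a primitive of a Green form back along a Möbius transformation. -/
theorem hasFDerivAt_primitive_moeb {lam s : ℂ} {v vg F : ℂ → ℂ} (hv : IsLaplaceEigen lam v)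
    (g : SL2) (hvg : ∀ z : ℂ, 0 < z.im → v (moeb g z) = vg z) {ζ ζ' : ℝ}
    (hd : (g 1 0 : ℝ) * ζ' + (g 1 1 : ℝ) ≠ 0)
    (hζ : ζ * ((g 1 0 : ℝ) * ζ' + (g 1 1 : ℝ)) = (g 0 0 : ℝ) * ζ' + (g 0 1 : ℝ))
    (hF : ∀ z : ℂ, 0 < z.im → HasFDerivAt F (greenForm v (Rpow s ζ) z) z) {z : ℂ}
    (hz : 0 < z.im) :
    HasFDerivAt (fun z => F (moeb g z))
      (greenForm (fun z => ((((g 1 0 : ℝ) * ζ' + (g 1 1 : ℝ)) ^ 2 : ℝ) : ℂ) ^ s * vg z)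
        (Rpow s ζ') z) z := by
  have hgz := moeb_im_pos g hz
  have hR (ζ : ℝ) {w : ℂ} (hw : 0 < w.im) : DifferentiableAt ℝ (Rpow s ζ) w :=
    ((isLaplaceEigen_Rpow s ζ).analytic w hw).differentiableAt
  have hnhds : {w : ℂ | 0 < w.im} ∈ nhds z := isOpen_setOf_im_pos.mem_nhds hz
  refine (hasFDerivAt_primitive_comp (hasDerivAt_moeb g hz)
    (hv.analytic _ hgz).differentiableAt (hR ζ hgz) (hF _ hgz)).congr_fderiv ?_
  have hvg' : DifferentiableAt ℝ vg z :=
    ((hv.analytic _ hgz).differentiableAt.comp z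
      ((hasDerivAt_moeb g hz).differentiableAt.restrictScalars ℝ)).congr_of_eventuallyEq
      (Filter.eventually_of_mem hnhds fun w hw => (hvg w hw).symm)
  rw [greenForm_const_mul_left _ _ _ hvg', ← greenForm_const_mul_right _ _ _ (hR ζ' hz)]
  exact greenForm_congr (Filter.eventually_of_mem hnhds hvg)
    (Filter.eventually_of_mem hnhds fun w hw => Rpow_moeb s g hw hd hζ)

open Set Filter Topology in
/-- If `f` has a right limit at `a` and a limit at infinity, the integral of `f'` over `(a, ∞)` is
their difference. -/
theorem integral_Ioi_of_hasDerivAt_of_tendsto_nhdsGT {E : Type*} [NormedAddCommGroup E]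
    [NormedSpace ℝ E] [CompleteSpace E] {f f' : ℝ → E} {a : ℝ} {l m : E}
    (hderiv : ∀ x ∈ Ioi a, HasDerivAt f (f' x) x) (hint : IntegrableOn f' (Ioi a))
    (ha : Tendsto f (𝓝[>] a) (𝓝 l)) (hf : Tendsto f atTop (𝓝 m)) :
    ∫ x in Ioi a, f' x = m - l := by
  have hev {x : ℝ} (hx : x ∈ Ioi a) : Function.update f a l =ᶠ[𝓝 x] f :=
    eventually_of_mem (Ioi_mem_nhds hx) fun y hy => Function.update_of_ne (ne_of_gt hy) _ _
  have := integral_Ioi_of_hasDerivAt_of_tendsto (f := Function.update f a l) (m := m)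
    (by rwa [continuousWithinAt_update_same, Ici_sdiff_left])
    (fun x hx => (hderiv x hx).congr_of_eventuallyEq (hev hx)) hint
    (hf.congr' (eventually_of_mem (Ioi_mem_atTop a) fun y hy =>
      (Function.update_of_ne (ne_of_gt hy) _ _).symm))
  simpa using this

theorem moeb_S (z : ℂ) : moeb ModularGroup.S z = -1 / z := by
  simp [moeb, ModularGroup.S]

theorem IsCuspidalEigen.const_mul {lam : ℂ} {v : ℂ → ℂ} (hv : IsCuspidalEigen lam v) (c : ℂ) :
    IsCuspidalEigen lam (fun z => c * v z) := by
  have han : AnalyticOnNhd ℝ (fun z => c * v z) {z : ℂ | 0 < z.im} := fun z hz =>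
    analyticAt_const.mul (hv.analytic z hz)
  refine ⟨⟨han, fun z hz => ?_⟩, fun C => ?_⟩
  · have h1 : fderiv ℝ (fun z => c * v z) =ᶠ[nhds z] fun z => c • fderiv ℝ v z :=
      Filter.eventually_of_mem (isOpen_setOf_im_pos.mem_nhds hz) fun w hw =>
        fderiv_const_mul (hv.analytic w hw).differentiableAt c
    have h2 := hv.eigen z hz
    rw [laplace_eq_fderiv (hv.analytic z hz)] at h2
    rw [laplace_eq_fderiv (han z hz), h1.fderiv_eq,
      fderiv_fun_const_smul (hv.analytic z hz).fderiv.differentiableAt]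
    simp only [smul_apply, smul_eq_mul]
    linear_combination c * h2
  · obtain ⟨K, T, h⟩ := hv.decay C
    refine ⟨‖c‖ * K, T, fun z hz hT => ?_⟩
    rw [norm_mul, mul_assoc]
    gcongr
    exact h z hz hT

theorem IsCuspidalEigen.add {lam : ℂ} {v w : ℂ → ℂ} (hv : IsCuspidalEigen lam v)
    (hw : IsCuspidalEigen lam w) : IsCuspidalEigen lam (fun z => v z + w z) := by
  have han : AnalyticOnNhd ℝ (fun z => v z + w z) {z : ℂ | 0 < z.im} := fun z hz =>
    (hv.analytic z hz).add (hw.analytic z hz)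
  refine ⟨⟨han, fun z hz => ?_⟩, fun C => ?_⟩
  · have h1 : fderiv ℝ (fun z => v z + w z) =ᶠ[nhds z] fun z => fderiv ℝ v z + fderiv ℝ w z :=
      Filter.eventually_of_mem (isOpen_setOf_im_pos.mem_nhds hz) fun x hx =>
        fderiv_fun_add (hv.analytic x hx).differentiableAt (hw.analytic x hx).differentiableAt
    have h2 := hv.eigen z hz
    have h3 := hw.eigen z hz
    rw [laplace_eq_fderiv (hv.analytic z hz)] at h2
    rw [laplace_eq_fderiv (hw.analytic z hz)] at h3
    rw [laplace_eq_fderiv (han z hz), h1.fderiv_eq,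
      fderiv_fun_add (hv.analytic z hz).fderiv.differentiableAt
        (hw.analytic z hz).fderiv.differentiableAt]
    simp only [add_apply]
    linear_combination h2 + h3
  · obtain ⟨K, T, h⟩ := hv.decay C
    obtain ⟨K', T', h'⟩ := hw.decay C
    refine ⟨K + K', max T T', fun z hz hT => (norm_add_le _ _).trans ?_⟩
    rw [add_mul]
    exact add_le_add (h z hz ((le_max_left _ _).trans hT)) (h' z hz ((le_max_right _ _).trans hT))

theorem isCuspidalEigen_zero (lam : ℂ) : IsCuspidalEigen lam (fun _ => 0) := by
  refine ⟨⟨fun z _ => analyticAt_const, fun z _ => ?_⟩, fun C => ⟨0, 0, by simp⟩⟩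
  simp [laplace_eq_fderiv (analyticAt_const (𝕜 := ℝ) (v := (0 : ℂ)) (x := z))]

theorem IsCuspidalEigen.sum {ι : Type*} {lam : ℂ} {v : ι → ℂ → ℂ} (t : Finset ι)
    (hv : ∀ k, IsCuspidalEigen lam (v k)) : IsCuspidalEigen lam (fun z => ∑ k ∈ t, v k z) := by
  classical
  induction t using Finset.induction_on with
  | empty => simpa using isCuspidalEigen_zero lam
  | insert a t ha ih => simpa only [Finset.sum_insert ha] using (hv a).add ih

open Set Filter Topology in
/-- The Green form of a cuspidal eigenfunction `v` and `R_ζ^s` is integrable along the geodesic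
from `0` to `i∞`, provided that `v ∘ S` is cuspidal too. -/
theorem IsCuspidalEigen.integrableOn_greenForm {s : ℂ} {v vS : ℂ → ℂ}
    (hv : IsCuspidalEigen (s * (1 - s)) v) (hvS : IsCuspidalEigen (s * (1 - s)) vS)
    (hS : ∀ z : ℂ, 0 < z.im → v (moeb ModularGroup.S z) = vS z) {ζ : ℝ} (hζ : ζ ≠ 0) :
    IntegrableOn (fun y : ℝ => greenForm v (Rpow s ζ) (y * Complex.I) Complex.I) (Ioi 0) := by
  obtain ⟨F, hF⟩ := hv.toIsLaplaceEigen.exists_primitive (isLaplaceEigen_Rpow s ζ)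
  have hG {z : ℂ} (hz : 0 < z.im) := hasFDerivAt_primitive_moeb (ζ' := -ζ⁻¹) hv.toIsLaplaceEigen
    ModularGroup.S hS (by simp [ModularGroup.S, hζ]) (by simp [ModularGroup.S, hζ]) hF hz
  obtain ⟨K, T₀, hK, hT₀, hb⟩ := (hvS.const_mul _).exists_greenForm_bound (-ζ⁻¹) 0
  have hcont := hv.toIsLaplaceEigen.continuousOn_greenForm_vertical (isLaplaceEigen_Rpow s ζ)
  obtain ⟨T, hT⟩ := hv.exists_integrableOn_Ioi ζ
  have ha : 0 < T₀⁻¹ := by positivity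
  have h1 : IntegrableOn (fun y : ℝ => greenForm v (Rpow s ζ) (y * Complex.I) Complex.I)
      (Ioc 0 T₀⁻¹) := by
    refine Integrable.mono' (integrable_const K)
      ((hcont.mono Ioc_subset_Ioi_self).aestronglyMeasurable measurableSet_Ioc) ?_
    refine (ae_restrict_iff' measurableSet_Ioc).2 (Eventually.of_forall fun y hy => ?_)
    have hy0 : 0 < y := hy.1
    have hyT : T₀ ≤ y⁻¹ := (le_inv_comm₀ (by linarith) hy0).2 hy.2
    have hd1 : HasDerivAt (fun y : ℝ => (y : ℂ) * Complex.I) Complex.I y := by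
      simpa using (Complex.ofRealCLM.hasDerivAt (x := y)).mul_const Complex.I
    have hd2 : HasDerivAt (fun y : ℝ => ((y⁻¹ : ℝ) : ℂ) * Complex.I)
        (((-(y ^ 2)⁻¹ : ℝ) : ℂ) * Complex.I) y :=
      (hasDerivAt_inv hy0.ne').ofReal_comp.mul_const Complex.I
    have hf1 := (hF (y * Complex.I) (by simpa using hy0)).comp_hasDerivAt y hd1
    have hf2 := (hG (z := ((y⁻¹ : ℝ) : ℂ) * Complex.I) (by simpa using hy0)).comp_hasDerivAt y hd2
    have heq : (F ∘ fun y : ℝ => (y : ℂ) * Complex.I) =ᶠ[𝓝 y]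
        ((fun z => F (moeb ModularGroup.S z)) ∘ fun y : ℝ => ((y⁻¹ : ℝ) : ℂ) * Complex.I) := by
      refine eventually_of_mem (Ioi_mem_nhds hy0) fun x hx => ?_
      have hx0 : (x : ℂ) ≠ 0 := by exact_mod_cast (ne_of_gt hx)
      simp only [Function.comp_apply, moeb_S]
      congr 1
      push_cast
      field_simp
      simp
    rw [hf1.unique (hf2.congr_of_eventuallyEq heq)]
    refine (ContinuousLinearMap.le_opNorm _ _).trans ?_
    refine (mul_le_mul_of_nonneg_right (hb _ (by simp) (by simpa using hyT))
      (norm_nonneg _)).trans (le_of_eq ?_)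
    rw [norm_mul, Complex.norm_real, Complex.norm_I, Real.norm_eq_abs, abs_neg,
      abs_of_nonneg (by positivity)]
    simp
    field_simp
  have h2 : IntegrableOn (fun y : ℝ => greenForm v (Rpow s ζ) (y * Complex.I) Complex.I)
      (Icc T₀⁻¹ (max T T₀⁻¹)) :=
    (hcont.mono fun y hy => ha.trans_le hy.1).integrableOn_Icc
  have h3 := (hT (max T T₀⁻¹) (le_max_left _ _)).2
  refine ((h1.union h2).union h3).mono_set fun y hy => ?_
  rcases le_or_gt y T₀⁻¹ with h | h
  · exact Or.inl (Or.inl ⟨hy, h⟩)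
  · rcases le_or_gt y (max T T₀⁻¹) with h' | h'
    · exact Or.inl (Or.inr ⟨h.le, h'⟩)
    · exact Or.inr h'

open Set Filter Topology in
/-- The integral of the Green form along the geodesic from `0` to `i∞` is the difference of the
limits of a primitive at the two cusps. -/
theorem IsCuspidalEigen.exists_integral_greenForm_eq {s : ℂ} {v vS F : ℂ → ℂ}
    (hv : IsCuspidalEigen (s * (1 - s)) v) (hvS : IsCuspidalEigen (s * (1 - s)) vS)
    (hS : ∀ z : ℂ, 0 < z.im → v (moeb ModularGroup.S z) = vS z) {ζ : ℝ} (hζ : ζ ≠ 0)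
    (hF : ∀ z : ℂ, 0 < z.im → HasFDerivAt F (greenForm v (Rpow s ζ) z) z) :
    ∃ L₀ L₁ : ℂ,
      (∀ x : ℝ, Tendsto (fun y : ℝ => F (moeb ModularGroup.S (x + y * Complex.I))) atTop (𝓝 L₀)) ∧
      (∀ x : ℝ, Tendsto (fun y : ℝ => F (x + y * Complex.I)) atTop (𝓝 L₁)) ∧
      ∫ y in Ioi (0 : ℝ), greenForm v (Rpow s ζ) (y * Complex.I) Complex.I = L₁ - L₀ := by
  have hG {z : ℂ} (hz : 0 < z.im) := hasFDerivAt_primitive_moeb (ζ' := -ζ⁻¹) hv.toIsLaplaceEigen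
    ModularGroup.S hS (by simp [ModularGroup.S, hζ]) (by simp [ModularGroup.S, hζ]) hF hz
  obtain ⟨L₀, hL₀⟩ := (hvS.const_mul _).exists_tendsto_primitive fun z hz => hG hz
  obtain ⟨L₁, hL₁⟩ := hv.exists_tendsto_primitive hF
  refine ⟨L₀, L₁, hL₀, hL₁, ?_⟩
  refine integral_Ioi_of_hasDerivAt_of_tendsto_nhdsGT (f := fun y : ℝ => F (y * Complex.I))
    (fun y hy => ?_) (hv.integrableOn_greenForm hvS hS hζ) ?_ (by simpa using hL₁ 0)
  · have hd1 : HasDerivAt (fun y : ℝ => (y : ℂ) * Complex.I) Complex.I y := by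
      simpa using (Complex.ofRealCLM.hasDerivAt (x := y)).mul_const Complex.I
    exact (hF (y * Complex.I) (by simpa using hy)).comp_hasDerivAt y hd1
  · refine ((hL₀ 0).comp tendsto_inv_nhdsGT_zero).congr' ?_
    filter_upwards [self_mem_nhdsWithin] with x hx
    have hx0 : (x : ℂ) ≠ 0 := by exact_mod_cast (ne_of_gt hx)
    simp only [Function.comp_apply, moeb_S]
    congr 1
    push_cast
    field_simp
    simp

open Matrix in
theorem IsVVCuspForm.isCuspidalEigen_dotProduct {n μ : ℕ} {α : Fin μ → SL2} {s : ℂ}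
    {U : ℂ → Fin μ → ℂ} (hU : IsVVCuspForm n α s U) (c : Fin μ → ℂ) :
    IsCuspidalEigen (s * (1 - s)) (fun z => c ⬝ᵥ U z) :=
  .sum Finset.univ fun k =>
    IsCuspidalEigen.const_mul ⟨⟨hU.analytic k, hU.eigen k⟩, hU.decay k⟩ (c k)

open Matrix in
theorem IsVVCuspForm.dotProduct_moeb {n μ : ℕ} {α : Fin μ → SL2} {s : ℂ} {U : ℂ → Fin μ → ℂ}
    (hU : IsVVCuspForm n α s U) (c : Fin μ → ℂ) (g : SL2) (z : ℂ) (hz : 0 < z.im) :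
    c ⬝ᵥ U (moeb g z) = (c ᵥ* rho n α g) ⬝ᵥ U z := by
  rw [← dotProduct_mulVec]
  congr 1
  funext j
  exact hU.equivar g z hz j

theorem greenForm_I_eq {v w : ℂ → ℂ} {z : ℂ} (hv : DifferentiableAt ℝ v z)
    (hw : DifferentiableAt ℝ w z) :
    v z * pdx w z - w z * pdx v z = greenForm v w z Complex.I := by
  rw [greenForm_apply, Complex.I_mul_I, map_neg, map_neg, pdx_eq_fderiv hv, pdx_eq_fderiv hw]
  ring

open Set in
theorem IsLaplaceEigen.Ptrans_eq {lam s : ℂ} {v : ℂ → ℂ} (hv : IsLaplaceEigen lam v) (ζ : ℝ) :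
    Ptrans s v ζ = ∫ y in Ioi (0 : ℝ), greenForm v (Rpow s ζ) (y * Complex.I) Complex.I :=
  setIntegral_congr_fun measurableSet_Ioi fun y hy =>
    have hy' : 0 < ((y : ℂ) * Complex.I).im := by simpa using hy
    greenForm_I_eq (hv.analytic _ hy').differentiableAt
      ((isLaplaceEigen_Rpow s ζ).analytic _ hy').differentiableAt

open Set Matrix in
theorem IsVVCuspForm.integrableOn_greenForm {n μ : ℕ} {α : Fin μ → SL2} {s : ℂ}
    {U : ℂ → Fin μ → ℂ} (hU : IsVVCuspForm n α s U) (i : Fin μ) {ζ : ℝ} (hζ : ζ ≠ 0) :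
    IntegrableOn (fun y : ℝ => greenForm (fun z => U z i) (Rpow s ζ) (y * Complex.I) Complex.I)
      (Ioi 0) := by
  have := (hU.isCuspidalEigen_dotProduct (Pi.single i 1)).integrableOn_greenForm
    (hU.isCuspidalEigen_dotProduct _) (hU.dotProduct_moeb _ ModularGroup.S) hζ
  simpa using this

theorem greenForm_sum_left {ι : Type*} (t : Finset ι) (c : ι → ℂ) {v : ι → ℂ → ℂ} (w : ℂ → ℂ)
    {z : ℂ} (hv : ∀ k ∈ t, DifferentiableAt ℝ (v k) z) :
    greenForm (fun z => ∑ k ∈ t, c k * v k z) w z = ∑ k ∈ t, c k • greenForm (v k) w z := by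
  ext1 h
  rw [greenForm_apply, fderiv_fun_sum fun k hk => (hv k hk).const_mul (c k)]
  simp only [sum_apply, smul_apply, greenForm_apply, Finset.mul_sum,
    Finset.sum_mul, smul_eq_mul, ← Finset.sum_sub_distrib]
  refine Finset.sum_congr rfl fun k hk => ?_
  rw [fderiv_const_mul (hv k hk), smul_apply, smul_eq_mul]
  ring

open Set Matrix in
theorem IsVVCuspForm.Ptrans_dotProduct {n μ : ℕ} {α : Fin μ → SL2} {s : ℂ}
    {U : ℂ → Fin μ → ℂ} (hU : IsVVCuspForm n α s U) (c : Fin μ → ℂ) {ζ : ℝ} (hζ : ζ ≠ 0) :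
    Ptrans s (fun z => c ⬝ᵥ U z) ζ = ∑ k, c k * Ptrans s (fun z => U z k) ζ := by
  have hk (k : Fin μ) : IsLaplaceEigen (s * (1 - s)) (fun z => U z k) :=
    ⟨hU.analytic k, hU.eigen k⟩
  rw [(hU.isCuspidalEigen_dotProduct c).toIsLaplaceEigen.Ptrans_eq]
  simp only [(hk _).Ptrans_eq, ← integral_const_mul]
  rw [← integral_finsetSum _ fun k _ => (hU.integrableOn_greenForm k hζ).const_mul (c k)]
  refine setIntegral_congr_fun measurableSet_Ioi fun y hy => ?_
  have hy' : 0 < ((y : ℂ) * Complex.I).im := by simpa using hy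
  have := greenForm_sum_left Finset.univ c (v := fun k z => U z k) (Rpow s ζ)
    fun k _ => (hU.analytic k _ hy').differentiableAt
  simp only [dotProduct, this]
  simp

open Set Filter Topology Matrix in
theorem IsVVCuspForm.exists_Ptrans_eq {n μ : ℕ} {α : Fin μ → SL2} {s : ℂ}
    {U : ℂ → Fin μ → ℂ} (hU : IsVVCuspForm n α s U) (c : Fin μ → ℂ) {ζ : ℝ} (hζ : ζ ≠ 0)
    {F : ℂ → ℂ}
    (hF : ∀ z : ℂ, 0 < z.im → HasFDerivAt F (greenForm (fun z => c ⬝ᵥ U z) (Rpow s ζ) z) z) :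
    ∃ L₀ L₁ : ℂ,
      (∀ x : ℝ, Tendsto (fun y : ℝ => F (moeb ModularGroup.S (x + y * Complex.I))) atTop (𝓝 L₀)) ∧
      (∀ x : ℝ, Tendsto (fun y : ℝ => F (x + y * Complex.I)) atTop (𝓝 L₁)) ∧
      ∑ k, c k * Ptrans s (fun z => U z k) ζ = L₁ - L₀ := by
  rw [← hU.Ptrans_dotProduct c hζ,
    (hU.isCuspidalEigen_dotProduct c).toIsLaplaceEigen.Ptrans_eq]
  exact (hU.isCuspidalEigen_dotProduct c).exists_integral_greenForm_eq
    (hU.isCuspidalEigen_dotProduct _) (hU.dotProduct_moeb _ ModularGroup.S) hζ hF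

open Matrix in
theorem IsVVCuspForm.hasFDerivAt_primitive_moeb {n μ : ℕ} {α : Fin μ → SL2} {s : ℂ}
    {U : ℂ → Fin μ → ℂ} (hU : IsVVCuspForm n α s U) (c : Fin μ → ℂ) (g : SL2) {ζ ζ' : ℝ}
    {F : ℂ → ℂ} (hd : (g 1 0 : ℝ) * ζ' + (g 1 1 : ℝ) ≠ 0)
    (hζ : ζ * ((g 1 0 : ℝ) * ζ' + (g 1 1 : ℝ)) = (g 0 0 : ℝ) * ζ' + (g 0 1 : ℝ))
    (hF : ∀ z : ℂ, 0 < z.im → HasFDerivAt F (greenForm (fun z => c ⬝ᵥ U z) (Rpow s ζ) z) z)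
    {z : ℂ} (hz : 0 < z.im) :
    HasFDerivAt (fun z => F (moeb g z))
      (greenForm (fun z => (((((g 1 0 : ℝ) * ζ' + (g 1 1 : ℝ)) ^ 2 : ℝ) : ℂ) ^ s •
        (c ᵥ* rho n α g)) ⬝ᵥ U z) (Rpow s ζ') z) z := by
  simpa only [smul_dotProduct, smul_eq_mul] using
    _root_.hasFDerivAt_primitive_moeb (hU.isCuspidalEigen_dotProduct c).toIsLaplaceEigen g
      (hU.dotProduct_moeb c g) hd hζ hF hz

theorem Tmat_inv_coe : (((Tmat⁻¹ : SL2)) : Matrix (Fin 2) (Fin 2) ℤ) = !![1, -1; 0, 1] := by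
  rw [Matrix.SpecialLinearGroup.coe_inv]
  simp [Tmat, Matrix.adjugate_fin_two_of]

theorem Tmat'_inv_coe : (((Tmat'⁻¹ : SL2)) : Matrix (Fin 2) (Fin 2) ℤ) = !![1, 0; -1, 1] := by
  rw [Matrix.SpecialLinearGroup.coe_inv]
  simp [Tmat', Matrix.adjugate_fin_two_of]

theorem moeb_Tmat_inv (z : ℂ) : moeb (Tmat⁻¹ : SL2) z = z - 1 := by
  simp only [moeb, Tmat_inv_coe]
  simp [sub_eq_add_neg]

theorem moeb_Tmat'_inv (z : ℂ) : moeb (Tmat'⁻¹ : SL2) z = z / (1 - z) := by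
  simp only [moeb, Tmat'_inv_coe]
  simp [sub_eq_add_neg, add_comm]

theorem inv_sq_cpow {x : ℝ} (hx : 0 < x) (s : ℂ) :
    (((x⁻¹ ^ 2 : ℝ)) : ℂ) ^ s = (x : ℂ) ^ (-(2 * s)) := by
  have hx' : (x : ℂ) ≠ 0 := by exact_mod_cast hx.ne'
  have h2 : (((x⁻¹ ^ 2 : ℝ)) : ℂ) ≠ 0 := by exact_mod_cast (by positivity : x⁻¹ ^ 2 ≠ 0)
  rw [Complex.cpow_def_of_ne_zero hx', Complex.cpow_def_of_ne_zero h2,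
    ← Complex.ofReal_log (by positivity), ← Complex.ofReal_log hx.le, Real.log_pow, Real.log_inv]
  push_cast
  ring_nf

/-- for `u⃗ ∈ S_ind(n,s)`, the integrals defining `(Pu⃗)_i(ζ)` converge
for `ζ > 0`, and `Pu⃗` satisfies the three term equation
`Pu⃗(ζ) = ρ(T⁻¹) Pu⃗(ζ+1) + (ζ+1)^{-2s} ρ(T'⁻¹) Pu⃗(ζ/(ζ+1))`. -/
theorem stmt16 (n : ℕ) (hn : 1 ≤ n) (s : ℂ) (μ : ℕ) (α : Fin μ → SL2)
    (hrep : IsCosetReps n α) (U : ℂ → Fin μ → ℂ) (hU : IsVVCuspForm n α s U) :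
    (∀ (i : Fin μ) (ζ : ℝ), 0 < ζ →
      MeasureTheory.IntegrableOn (fun y : ℝ =>
          U (y * Complex.I) i * pdx (Rpow s ζ) (y * Complex.I)
            - Rpow s ζ (y * Complex.I) * pdx (fun w => U w i) (y * Complex.I))
        (Set.Ioi (0 : ℝ))) ∧
    (∀ ζ : ℝ, 0 < ζ → ∀ i : Fin μ,
      Ptrans s (fun w => U w i) ζ
        = (∑ k, rho n α Tmat⁻¹ i k * Ptrans s (fun w => U w k) (ζ + 1))
          + ((ζ + 1 : ℝ) : ℂ) ^ (-(2 * s))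
            * ∑ k, rho n α Tmat'⁻¹ i k * Ptrans s (fun w => U w k) (ζ / (ζ + 1))) := by


  refine ⟨fun i ζ hζ => ?_, fun ζ hζ i => ?_⟩
  · refine (hU.integrableOn_greenForm i hζ.ne').congr_fun (fun y hy => ?_) measurableSet_Ioi
    have hy' : 0 < ((y : ℂ) * Complex.I).im := by simpa using hy
    exact (greenForm_I_eq (hU.analytic i _ hy').differentiableAt
      ((isLaplaceEigen_Rpow s ζ).analytic _ hy').differentiableAt).symm
  have hζ1 : 0 < ζ + 1 := by linarith
  obtain ⟨F, hF⟩ := (hU.isCuspidalEigen_dotProduct (Pi.single i 1)).toIsLaplaceEigen.exists_primitive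
    (isLaplaceEigen_Rpow s ζ)
  have hd : 1 - ζ / (ζ + 1) = (ζ + 1)⁻¹ := by field_simp; ring
  have hF₁ {z : ℂ} (hz : 0 < z.im) := hU.hasFDerivAt_primitive_moeb (ζ' := ζ + 1) (Pi.single i 1)
    Tmat⁻¹ (by simp only [Tmat_inv_coe]; simp) (by simp only [Tmat_inv_coe]; simp) hF hz
  have hF₂ {z : ℂ} (hz : 0 < z.im) := hU.hasFDerivAt_primitive_moeb (ζ' := ζ / (ζ + 1))
    (Pi.single i 1) Tmat'⁻¹
    (by simp only [Tmat'_inv_coe]; simp [neg_add_eq_sub, hd, hζ1.ne'])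
    (by simp only [Tmat'_inv_coe]; simp [neg_add_eq_sub, hd, ← div_eq_mul_inv]) hF hz
  obtain ⟨L₀, L₁, h₀, h₁, h⟩ := hU.exists_Ptrans_eq _ hζ.ne' hF
  obtain ⟨M₀, M₁, hM₀, hM₁, hM⟩ := hU.exists_Ptrans_eq _ hζ1.ne' fun z hz => hF₁ hz
  obtain ⟨N₀, N₁, hN₀, hN₁, hN⟩ := hU.exists_Ptrans_eq _ (div_pos hζ hζ1).ne' fun z hz => hF₂ hz
  have e₁ : M₁ = L₁ := by
    refine tendsto_nhds_unique (hM₁ 1) ((h₁ 0).congr fun y => ?_)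
    simp only [moeb_Tmat_inv]
    congr 1
    simp
  have e₂ : M₀ = N₁ := by
    refine tendsto_nhds_unique (hM₀ 0) ((hN₁ 1).congr' ?_)
    filter_upwards [Filter.eventually_gt_atTop 0] with y hy
    have hy0 : (y : ℂ) ≠ 0 := by exact_mod_cast hy.ne'
    simp only [moeb_Tmat_inv, moeb_Tmat'_inv, moeb_S]
    congr 1
    push_cast
    field_simp
    ring
  have e₃ : N₀ = L₀ := by
    refine tendsto_nhds_unique (hN₀ 0) ((h₀ 1).congr' ?_)
    filter_upwards [Filter.eventually_gt_atTop 0] with y hy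
    have hy0 : (y : ℂ) ≠ 0 := by exact_mod_cast hy.ne'
    have hy1 : 1 + (y : ℂ) * Complex.I ≠ 0 := fun h => by simpa using congrArg Complex.re h
    have hy2 : 1 - -1 / ((y : ℂ) * Complex.I) ≠ 0 := by
      intro h
      apply hy1
      field_simp at h
      linear_combination h
    simp only [moeb_Tmat'_inv, moeb_S]
    congr 1
    simp only [Complex.ofReal_one, Complex.ofReal_zero, zero_add]
    rw [div_eq_div_iff hy1 hy2]
    field_simp
    ring
  have hcoef : (((((Tmat'⁻¹ : SL2) 1 0 : ℝ) * (ζ / (ζ + 1)) + ((Tmat'⁻¹ : SL2) 1 1 : ℝ)) ^ 2 : ℝ) : ℂ)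
      ^ s = ((ζ + 1 : ℝ) : ℂ) ^ (-(2 * s)) := by
    rw [← inv_sq_cpow hζ1, ← hd]
    congr 3
    simp only [Tmat'_inv_coe]
    simp
    ring
  have hcoef₁ : (((((Tmat⁻¹ : SL2) 1 0 : ℝ) * (ζ + 1) + ((Tmat⁻¹ : SL2) 1 1 : ℝ)) ^ 2 : ℝ) : ℂ) ^ s
      = 1 := by
    simp only [Tmat_inv_coe]
    simp
  rw [hcoef] at hN
  rw [hcoef₁] at hM
  simp only [Pi.smul_apply, smul_eq_mul, mul_assoc, one_mul, ← Finset.mul_sum,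
    Matrix.single_one_vecMul, Matrix.row_apply] at hM hN
  simp only [Pi.single_apply, ite_mul, one_mul, zero_mul, Finset.sum_ite_eq', Finset.mem_univ,
    if_true] at h
  rw [h, hM, hN, e₁, e₂, e₃]
  ring

end
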